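/- arXiv:2004.10460 — 5 statements merged into one kernel-verified Lean document; each statement's English description precedes it below -/
import Mathlib

section
/- Let U be a compact evolution family on X. Define the Cauchy operator G on C([0,T];X) by (Gφ)(t) = ∫₀^t U(t,s)(φ(s)) ds for t ∈ [0,T]. Then Gφ ∈ C([0,T];X) for each φ ∈ C([0,T];X), G is a bounded linear operator, and G is a compact operator: for every R > 0, the image under G of the closed ball {φ ∈ C([0,T];X) : sup_{t∈[0,T]} ‖φ(t)‖ ≤ R} is relatively compact in C([0,T];X). -/
open MeasureTheory Set

/-- A compact evolution family `U(t,s)`, `0 ≤ s ≤ t ≤ T`, of bounded linear operators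
on `X`: an evolution family such that `U(t,s)` is a compact operator whenever `s < t`. -/
structure CompactEvolutionFamily (T : ℝ) (X : Type*)
    [NormedAddCommGroup X] [NormedSpace ℝ X] where
  U : ℝ → ℝ → X →L[ℝ] X
  C : ℝ
  C_ge_one : 1 ≤ C
  idem : ∀ s, 0 ≤ s → s ≤ T → U s s = ContinuousLinearMap.id ℝ X
  comp : ∀ s r t, 0 ≤ s → s ≤ r → r ≤ t → t ≤ T → (U t r).comp (U r s) = U t s
  strong_cont : ∀ x : X, ContinuousOn (fun p : ℝ × ℝ => U p.1 p.2 x)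
    {p : ℝ × ℝ | 0 ≤ p.2 ∧ p.2 ≤ p.1 ∧ p.1 ≤ T}
  norm_bound : ∀ s t, 0 ≤ s → s ≤ t → t ≤ T → ‖U t s‖ ≤ C
  compact : ∀ s t, 0 ≤ s → s < t → t ≤ T → IsCompactOperator (U t s)

/-- A set is totally bounded if, for every `ε`, some map with totally bounded image separates
the `ε`-distant points of the set. -/
theorem Metric.totallyBounded_of_forall_exists_map {α ι : Type*} {β : ι → Type*}
    [PseudoMetricSpace α] [∀ i, PseudoMetricSpace (β i)] {S : Set α}
    (H : ∀ ε > 0, ∃ (i : ι) (Φ : α → β i), TotallyBounded (Φ '' S) ∧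
      ∃ δ > 0, ∀ x ∈ S, ∀ y ∈ S, dist (Φ x) (Φ y) < δ → dist x y < ε) :
    TotallyBounded S := by
  rw [Metric.totallyBounded_iff]
  intro ε hε
  obtain ⟨_, Φ, hΦ, δ, hδ, h⟩ := H ε hε
  obtain ⟨t, htS, htf, hcover⟩ := Metric.finite_approx_of_totallyBounded hΦ δ hδ
  obtain ⟨u, huS, huf, rfl⟩ := exists_subset_image_finite_and.1 ⟨t, htS, htf, rfl⟩
  refine ⟨u, huf, fun x hx => ?_⟩
  obtain ⟨_, ⟨y, hy, rfl⟩, hxy⟩ := mem_iUnion₂.1 (hcover (mem_image_of_mem Φ hx))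
  exact mem_iUnion₂.2 ⟨y, hy, h x hx y (huS hy) hxy⟩

theorem ContinuousMap.norm_IccExtend_le {X : Type*} [NormedAddCommGroup X] {a b : ℝ} (h : a ≤ b)
    (φ : C(Icc a b, X)) (s : ℝ) : ‖IccExtend h φ s‖ ≤ ‖φ‖ :=
  φ.norm_coe_le_norm _

namespace CompactEvolutionFamily

variable {T : ℝ} {X : Type*} [NormedAddCommGroup X] [NormedSpace ℝ X]
  (E : CompactEvolutionFamily T X)

theorem C_pos : 0 < E.C := one_pos.trans_le E.C_ge_one

theorem norm_apply_le {s t : ℝ} (hs : 0 ≤ s) (hst : s ≤ t) (ht : t ≤ T) (x : X) :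
    ‖E.U t s x‖ ≤ E.C * ‖x‖ :=
  (E.U t s).le_of_opNorm_le (E.norm_bound s t hs hst ht) x

theorem apply_apply {s r t : ℝ} (hs : 0 ≤ s) (hsr : s ≤ r) (hrt : r ≤ t) (ht : t ≤ T) (x : X) :
    E.U t r (E.U r s x) = E.U t s x := by
  rw [← E.comp s r t hs hsr hrt ht, ContinuousLinearMap.comp_apply]

/-- An evolution family is jointly continuous in the two times and the vector. -/
theorem continuousOn_apply :
    ContinuousOn (fun q : (ℝ × ℝ) × X => E.U q.1.1 q.1.2 q.2)
      ({p : ℝ × ℝ | 0 ≤ p.2 ∧ p.2 ≤ p.1 ∧ p.1 ≤ T} ×ˢ univ) := by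
  refine continuousOn_prod_of_continuousOn_lipschitzOnWith' _ ⟨E.C, E.C_pos.le⟩ ?_
    fun x _ => E.strong_cont x
  rintro p ⟨h0, h1, h2⟩
  exact ((E.U p.1 p.2).lipschitz.weaken (E.norm_bound _ _ h0 h1 h2)).lipschitzOnWith

/-- The Cauchy integral `∫₀ᵗ U(t,s) g(s) ds`. -/
noncomputable def cauchyIntegral (g : ℝ → X) (t : ℝ) : X :=
  ∫ s in (0 : ℝ)..t, E.U t s (g s)

theorem intervalIntegrable {g : ℝ → X} (hg : Continuous g) {a b t : ℝ} (ha : 0 ≤ a)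
    (hab : a ≤ b) (hbt : b ≤ t) (ht : t ≤ T) :
    IntervalIntegrable (fun s => E.U t s (g s)) volume a b := by
  refine ContinuousOn.intervalIntegrable ?_
  rw [uIcc_of_le hab]
  refine E.continuousOn_apply.comp (f := fun s : ℝ => ((t, s), g s)) (by fun_prop) ?_
  exact fun s hs => ⟨⟨ha.trans hs.1, hs.2.trans hbt, ht⟩, mem_univ _⟩

theorem norm_integral_le {g : ℝ → X} {R : ℝ} (hR : ∀ s, ‖g s‖ ≤ R) {a b t : ℝ}
    (ha : 0 ≤ a) (hab : a ≤ b) (hbt : b ≤ t) (ht : t ≤ T) :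
    ‖∫ s in a..b, E.U t s (g s)‖ ≤ E.C * R * (b - a) := by
  have h := intervalIntegral.norm_integral_le_of_norm_le_const (a := a) (b := b)
    (f := fun s => E.U t s (g s)) (C := E.C * R) fun s hs => by
      rw [uIoc_of_le hab] at hs
      exact (E.norm_apply_le (ha.trans hs.1.le) (hs.2.trans hbt) ht _).trans
        (mul_le_mul_of_nonneg_left (hR s) E.C_pos.le)
  rwa [abs_of_nonneg (sub_nonneg.2 hab)] at h

theorem norm_cauchyIntegral_le {g : ℝ → X} {R : ℝ} (hR : ∀ s, ‖g s‖ ≤ R) {t : ℝ}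
    (h0 : 0 ≤ t) (ht : t ≤ T) : ‖E.cauchyIntegral g t‖ ≤ E.C * R * t := by
  simpa [cauchyIntegral] using E.norm_integral_le hR le_rfl h0 le_rfl ht

theorem continuous_cauchyIntegral {g : ℝ → X} (hg : Continuous g) :
    Continuous fun t : Icc (0 : ℝ) T => E.cauchyIntegral g t := by
  have hcont : Continuous
      (Function.uncurry fun (t : Icc (0 : ℝ) T) (s : ℝ) =>
        E.U t (max 0 (min s t)) (g (max 0 (min s t)))) := by
    refine E.continuousOn_apply.comp_continuous
      (f := fun p : Icc (0 : ℝ) T × ℝ =>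
        (((p.1 : ℝ), max 0 (min p.2 p.1)), g (max 0 (min p.2 p.1)))) (by fun_prop) ?_
    exact fun p => ⟨⟨le_max_left _ _, max_le p.1.2.1 (min_le_right _ _), p.1.2.2⟩, mem_univ _⟩
  refine (intervalIntegral.continuous_parametric_intervalIntegral_of_continuous (μ := volume)
    (a₀ := 0) hcont continuous_subtype_val).congr fun t => ?_
  refine intervalIntegral.integral_congr fun s hs => ?_
  rw [uIcc_of_le t.2.1] at hs
  simp [min_eq_left hs.2, max_eq_right hs.1]

theorem cauchyIntegral_eq_add [CompleteSpace X] {g : ℝ → X} (hg : Continuous g) {a t : ℝ}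
    (ha : 0 ≤ a) (hat : a ≤ t) (ht : t ≤ T) :
    E.cauchyIntegral g t = E.U t a (E.cauchyIntegral g a) + ∫ s in a..t, E.U t s (g s) := by
  rw [cauchyIntegral, cauchyIntegral,
    ← (E.U t a).intervalIntegral_comp_comm
      (E.intervalIntegrable hg le_rfl ha le_rfl (hat.trans ht)),
    ← intervalIntegral.integral_add_adjacent_intervals
      (E.intervalIntegrable hg le_rfl ha hat ht) (E.intervalIntegrable hg ha hat le_rfl ht)]
  congr 1
  refine intervalIntegral.integral_congr fun s hs => ?_
  rw [uIcc_of_le ha] at hs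
  exact (E.apply_apply hs.1 hs.2 hat ht _).symm

/-- On the grid of mesh `h`, the Cauchy integral is controlled by its values at the grid points
`k * h`, propagated by one step of the evolution family. -/
theorem norm_cauchyIntegral_le_of_grid [CompleteSpace X] {g : ℝ → X} (hg : Continuous g)
    {R : ℝ} (hR : ∀ s, ‖g s‖ ≤ R) {h δ : ℝ} (hh : 0 < h) (hδ : 0 ≤ δ)
    (hgrid : ∀ k : ℕ, (k + 1) * h ≤ T →
      ‖E.U ((k + 1) * h) (k * h) (E.cauchyIntegral g (k * h))‖ ≤ δ)
    {t : ℝ} (h0 : 0 ≤ t) (ht : t ≤ T) :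
    ‖E.cauchyIntegral g t‖ ≤ E.C * δ + E.C * R * (2 * h) := by
  have hCR : 0 ≤ E.C * R := mul_nonneg E.C_pos.le ((norm_nonneg _).trans (hR 0))
  have hle : ⌊t / h⌋₊ * h ≤ t := (le_div_iff₀ hh).1 (Nat.floor_le (div_nonneg h0 hh.le))
  have hlt : t < (⌊t / h⌋₊ + 1) * h := (div_lt_iff₀ hh).1 (Nat.lt_floor_add_one _)
  rcases hk : ⌊t / h⌋₊ with _ | k
  · rw [hk, Nat.cast_zero] at hlt
    refine (E.norm_cauchyIntegral_le hR h0 ht).trans ?_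
    have := mul_le_mul_of_nonneg_left (show t ≤ 2 * h by linarith) hCR
    linarith [mul_nonneg E.C_pos.le hδ]
  · rw [hk, Nat.cast_succ] at hle hlt
    have hk0 : 0 ≤ k * h := by positivity
    have hk1 : k * h ≤ (k + 1) * h := by linarith
    rw [E.cauchyIntegral_eq_add hg hk0 (hk1.trans hle) ht, ← E.apply_apply hk0 hk1 hle ht]
    refine (norm_add_le _ _).trans (add_le_add ?_ ?_)
    · exact (E.norm_apply_le (hk0.trans hk1) hle ht _).trans
        (mul_le_mul_of_nonneg_left (hgrid k (hle.trans ht)) E.C_pos.le)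
    · exact (E.norm_integral_le hR hk0 (hk1.trans hle) le_rfl ht).trans
        (mul_le_mul_of_nonneg_left (by linarith) hCR)

/-- The Cauchy operator on `C([0,T];X)`. -/
noncomputable def cauchyOperator (hT : 0 ≤ T) :
    C(Icc (0 : ℝ) T, X) →L[ℝ] C(Icc (0 : ℝ) T, X) :=
  LinearMap.mkContinuous
    { toFun := fun φ =>
        ⟨fun t => E.cauchyIntegral (IccExtend hT φ) t,
          E.continuous_cauchyIntegral φ.continuous.Icc_extend'⟩
      map_add' := fun φ ψ => by
        ext t
        have hφ := E.intervalIntegrable (φ.continuous.Icc_extend' (h := hT)) le_rfl t.2.1 le_rfl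
          t.2.2
        have hψ := E.intervalIntegrable (ψ.continuous.Icc_extend' (h := hT)) le_rfl t.2.1 le_rfl
          t.2.2
        simpa [cauchyIntegral, IccExtend] using intervalIntegral.integral_add hφ hψ
      map_smul' := fun c φ => by
        ext t
        simp [cauchyIntegral, IccExtend] }
    (E.C * T) fun φ => by
      have hC := E.C_pos
      refine (ContinuousMap.norm_le _ (by positivity)).2 fun t => ?_
      calc ‖E.cauchyIntegral (IccExtend hT φ) t‖ ≤ E.C * ‖φ‖ * t :=
            E.norm_cauchyIntegral_le (φ.norm_IccExtend_le hT) t.2.1 t.2.2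
        _ ≤ E.C * ‖φ‖ * T := by gcongr; exact t.2.2
        _ = E.C * T * ‖φ‖ := by ring

theorem cauchyOperator_apply (hT : 0 ≤ T) (φ : C(Icc (0 : ℝ) T, X)) (t : Icc (0 : ℝ) T) :
    E.cauchyOperator hT φ t = E.cauchyIntegral (IccExtend hT φ) t :=
  rfl

theorem totallyBounded_image_cauchyOperator [CompleteSpace X] (hT : 0 < T) (R : ℝ) :
    TotallyBounded (E.cauchyOperator hT.le '' Metric.closedBall 0 R) := by
  refine Metric.totallyBounded_of_forall_exists_map (β := fun n => Fin n → X) fun ε hε => ?_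
  have hC := E.C_pos
  set G := E.cauchyOperator hT.le
  obtain ⟨n, hn⟩ := exists_nat_gt (max 0 (8 * E.C * R * T / ε))
  have hn0 : (0 : ℝ) < n := (le_max_left _ _).trans_lt hn
  set h : ℝ := T / n
  have hh : 0 < h := div_pos hT hn0
  have hnh : n * h = T := mul_div_cancel₀ T hn0.ne'
  have hsmall : E.C * (2 * R) * (2 * h) < ε / 2 := by
    have := (div_lt_iff₀ hε).1 ((le_max_right _ _).trans_lt hn)
    rw [show E.C * (2 * R) * (2 * h) = 4 * E.C * R * T / n by simp only [h]; ring,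
      div_lt_iff₀ hn0]
    linarith
  have hmem : ∀ k : ℕ, k < n → (k : ℝ) * h ∈ Icc (0 : ℝ) T := fun k hk =>
    ⟨by positivity, by rw [← hnh]; gcongr⟩
  have hstep : ∀ k : Fin n, ((k : ℕ) + 1 : ℝ) * h ≤ T := fun k => by
    rw [← hnh]
    gcongr
    exact_mod_cast k.2
  refine ⟨n, fun u k => E.U ((k + 1) * h) (k * h) (u ⟨k * h, hmem k k.2⟩), ?_,
    ε / (2 * E.C), by positivity, ?_⟩
  · choose K hK hKsub using fun k : Fin n =>
      (E.compact (k * h) ((k + 1) * h) (hmem k k.2).1 (by linarith)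
        (hstep k)).image_closedBall_subset_compact (f := (E.U ((k + 1) * h) (k * h) : X →ₗ[ℝ] X))
        (‖G‖ * R)
    refine (isCompact_univ_pi hK).totallyBounded.subset ?_
    rintro _ ⟨_, ⟨φ, hφ, rfl⟩, rfl⟩ k -
    refine hKsub k (mem_image_of_mem _ ?_)
    rw [mem_closedBall_zero_iff] at hφ ⊢
    exact ((G φ).norm_coe_le_norm _).trans (G.le_opNorm_of_le hφ)
  · rintro _ ⟨φ, hφ, rfl⟩ _ ⟨ψ, hψ, rfl⟩ hdist
    rw [mem_closedBall_zero_iff] at hφ hψ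
    have hR : ∀ s, ‖IccExtend hT.le (φ - ψ) s‖ ≤ 2 * R := fun s =>
      ((φ - ψ).norm_IccExtend_le hT.le s).trans ((norm_sub_le _ _).trans (by linarith))
    rw [dist_eq_norm, ← map_sub]
    refine ((ContinuousMap.norm_le _ (C := ε / 2 + E.C * (2 * R) * (2 * h)) ?_).2
      fun t => ?_).trans_lt (by linarith)
    · have : 0 ≤ R := (norm_nonneg _).trans hφ
      positivity
    · have hgrid := E.norm_cauchyIntegral_le_of_grid (δ := ε / (2 * E.C))
        (φ - ψ).continuous.Icc_extend' hR hh (by positivity) (fun k hk => ?_) t.2.1 t.2.2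
      · rwa [show E.C * (ε / (2 * E.C)) = ε / 2 by field_simp] at hgrid
      · have hkn : k < n := by
          rw [← hnh] at hk
          exact_mod_cast (lt_add_one (k : ℝ)).trans_le (le_of_mul_le_mul_right hk hh)
        have hd := (dist_le_pi_dist _ _ (⟨k, hkn⟩ : Fin n)).trans hdist.le
        rw [dist_eq_norm, ← map_sub, ← ContinuousMap.sub_apply, ← map_sub] at hd
        exact hd

end CompactEvolutionFamily

/-- The Cauchy operator `(Gφ)(t) = ∫₀ᵗ U(t,s) φ(s) ds` of a compact evolution family
is a well-defined bounded linear operator on `C([0,T];X)`, and it is a compact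
operator: the image of every closed ball of `C([0,T];X)` is relatively compact. -/
theorem cauchy_operator_compact
    {X : Type*} [NormedAddCommGroup X] [NormedSpace ℝ X] [CompleteSpace X]
    (T : ℝ) (hT : 0 < T) (E : CompactEvolutionFamily T X) :
    ∃ G : C(Icc (0:ℝ) T, X) →L[ℝ] C(Icc (0:ℝ) T, X),
      (∀ (φ : C(Icc (0:ℝ) T, X)) (t : Icc (0:ℝ) T),
        G φ t = ∫ s in Icc (0:ℝ) (t:ℝ), E.U (t:ℝ) s (IccExtend hT.le φ s)) ∧
      ∀ R : ℝ, 0 < R → IsCompact (closure (⇑G '' Metric.closedBall 0 R)) := by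
  refine ⟨E.cauchyOperator hT.le, fun φ t => ?_, fun R _ => ?_⟩
  · rw [E.cauchyOperator_apply, CompactEvolutionFamily.cauchyIntegral,
      intervalIntegral.integral_of_le t.2.1, integral_Icc_eq_integral_Ioc]
  · exact (totallyBounded_closure.2
      (E.totallyBounded_image_cauchyOperator hT R)).isCompact_of_isClosed isClosed_closure
end

section
/- Let U be a compact evolution family on X, and let G denote the Cauchy operator from L²([0,T];X) to C([0,T];X) given by (Gφ)(t) = ∫₀^t U(t,s)(φ(s)) ds. If a sequence (φ_n) converges weakly to φ in L²([0,T];X) (i.e., F(φ_n) → F(φ) for every continuous linear functional F on L²([0,T];X)), then Gφ_n converges to Gφ in C([0,T];X), i.e., sup_{t∈[0,T]} ‖∫₀^t U(t,s)(φ_n(s)) ds − ∫₀^t U(t,s)(φ(s)) ds‖ → 0 as n → ∞. -/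
open MeasureTheory Set Filter

open scoped Topology ENNReal

/-- A weakly convergent sequence in a normed space is norm bounded. -/
theorem exists_norm_le_of_tendsto_dual {E : Type*} [NormedAddCommGroup E] [NormedSpace ℝ E]
    {x : ℕ → E} {x₀ : E}
    (hx : ∀ f : E →L[ℝ] ℝ, Tendsto (fun n => f (x n)) atTop (𝓝 (f x₀))) :
    ∃ M, ∀ n, ‖x n‖ ≤ M := by
  obtain ⟨M, hM⟩ := banach_steinhaus
    (g := fun n => NormedSpace.inclusionInDoubleDual ℝ E (x n)) fun f => by
      obtain ⟨M, hM⟩ := (hx f).norm.bddAbove_range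
      exact ⟨M, fun n => hM ⟨n, rfl⟩⟩
  refine ⟨M, fun n => ?_⟩
  rw [← (NormedSpace.inclusionInDoubleDualLi (E := E) ℝ).norm_map (x n)]
  exact hM n

/-- A compact operator maps weakly convergent sequences to norm convergent ones. -/
theorem IsCompactOperator.tendsto_of_tendsto_dual {E F : Type*}
    [NormedAddCommGroup E] [NormedSpace ℝ E] [NormedAddCommGroup F] [NormedSpace ℝ F]
    {K : E →L[ℝ] F} (hK : IsCompactOperator K) {x : ℕ → E} {x₀ : E}
    (hx : ∀ f : E →L[ℝ] ℝ, Tendsto (fun n => f (x n)) atTop (𝓝 (f x₀))) :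
    Tendsto (fun n => K (x n)) atTop (𝓝 (K x₀)) := by
  obtain ⟨M, hM⟩ := exists_norm_le_of_tendsto_dual hx
  have hcpt : IsCompact (closure (K '' Metric.closedBall 0 M)) :=
    IsCompactOperator.isCompact_closure_image_closedBall (f := K.toLinearMap) hK M
  refine hcpt.tendsto_nhds_of_unique_mapClusterPt
    (Eventually.of_forall fun n => subset_closure ⟨x n, by simpa using hM n, rfl⟩) ?_
  intro y _ hy
  refine (SeparatingDual.eq_iff_forall_dual_eq (R := ℝ)).2 fun g => ?_
  have hgy : MapClusterPt (g y) atTop (g ∘ fun n => K (x n)) :=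
    hy.tendsto_comp g.continuous.continuousAt
  have hlim : Tendsto (g ∘ fun n => K (x n)) atTop (𝓝 (g (K x₀))) := hx (g.comp K)
  exact eq_of_nhds_neBot (hgy.clusterPt.mono hlim)

namespace CompactEvolutionFamily

variable {X : Type*} [NormedAddCommGroup X] [NormedSpace ℝ X] {T : ℝ}

theorem aestronglyMeasurable_apply (E : CompactEvolutionFamily T X) {a t : ℝ}
    (ha : 0 ≤ a) (htT : t ≤ T) {f : ℝ → X}
    (hf : AEStronglyMeasurable f (volume.restrict (Icc a t))) :
    AEStronglyMeasurable (fun s => E.U t s (f s)) (volume.restrict (Icc a t)) := by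
  have hconst : ∀ x : X, AEStronglyMeasurable (fun s => E.U t s x)
      (volume.restrict (Icc a t)) := fun x => by
    refine ContinuousOn.aestronglyMeasurable ?_ measurableSet_Icc
    exact (E.strong_cont x).comp (f := fun s : ℝ => (t, s)) (by fun_prop)
      fun s hs => ⟨ha.trans hs.1, hs.2, htT⟩
  have hsimple : ∀ g : SimpleFunc ℝ X, AEStronglyMeasurable (fun s => E.U t s (g s))
      (volume.restrict (Icc a t)) := fun g => by
    induction g using SimpleFunc.induction with
    | const c hS =>
      rename_i S
      have heq : (fun s => E.U t s ((SimpleFunc.piecewise S hS (SimpleFunc.const _ c)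
          (SimpleFunc.const _ 0)) s)) = S.indicator fun s => E.U t s c := by
        ext s
        by_cases hs : s ∈ S <;> simp [hs]
      rw [heq]
      exact (hconst c).indicator hS
    | add _ hg hh =>
      simpa using! hg.add hh
  obtain ⟨f', hf', hff'⟩ := hf
  refine AEStronglyMeasurable.congr (f := fun s => E.U t s (f' s)) ?_
    (hff'.mono fun s hs => by simp only [hs])
  exact aestronglyMeasurable_of_tendsto_ae atTop (fun n => hsimple (hf'.approx n))
    (Eventually.of_forall fun s =>
      (E.U t s).continuous.continuousAt.tendsto.comp (hf'.tendsto_approx s))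

theorem eLpNorm_apply_le (E : CompactEvolutionFamily T X) {a t : ℝ}
    (ha : 0 ≤ a) (htT : t ≤ T) (f : Lp X 2 (volume.restrict (Icc (0:ℝ) T))) :
    eLpNorm (fun s => E.U t s (f s)) 1 (volume.restrict (Icc a t)) ≤
      ENNReal.ofReal (E.C * √(t - a) * ‖f‖) := by
  have hle : volume.restrict (Icc a t) ≤ volume.restrict (Icc (0:ℝ) T) :=
    Measure.restrict_mono (Icc_subset_Icc ha htT) le_rfl
  have hC : 0 ≤ E.C := zero_le_one.trans E.C_ge_one
  have hbound : eLpNorm (fun s => E.U t s (f s)) 2 (volume.restrict (Icc a t)) ≤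
      ENNReal.ofReal E.C * eLpNorm f 2 (volume.restrict (Icc a t)) := by
    refine eLpNorm_le_mul_eLpNorm_of_ae_le_mul ?_ 2
    filter_upwards [ae_restrict_mem measurableSet_Icc] with s hs
    exact (E.U t s).le_of_opNorm_le (E.norm_bound s t (ha.trans hs.1) hs.2 htT) _
  have hnorm : eLpNorm f 2 (volume.restrict (Icc (0:ℝ) T)) = ENNReal.ofReal ‖f‖ := by
    rw [Lp.norm_def, ENNReal.ofReal_toReal (Lp.eLpNorm_ne_top f)]
  have hsqrt : (volume.restrict (Icc a t)) univ ^ (1 / (1 : ℝ≥0∞).toReal - 1 / (2 : ℝ≥0∞).toReal)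
      = ENNReal.ofReal √(t - a) := by
    rw [Measure.restrict_apply_univ, Real.volume_Icc, Real.sqrt_eq_rpow]
    norm_num
    rcases le_total 0 (t - a) with h | h
    · rw [ENNReal.ofReal_rpow_of_nonneg h (by norm_num)]
    · rw [← Real.sqrt_eq_rpow, Real.sqrt_eq_zero_of_nonpos h, ENNReal.ofReal_of_nonpos h]
      simp
  have hmeas := E.aestronglyMeasurable_apply ha htT ((Lp.aestronglyMeasurable f).mono_measure hle)
  calc eLpNorm (fun s => E.U t s (f s)) 1 (volume.restrict (Icc a t))
      ≤ eLpNorm (fun s => E.U t s (f s)) 2 (volume.restrict (Icc a t)) *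
          ENNReal.ofReal √(t - a) := by
        rw [← hsqrt]
        exact eLpNorm_le_eLpNorm_mul_rpow_measure_univ one_le_two hmeas
    _ ≤ ENNReal.ofReal E.C * ENNReal.ofReal ‖f‖ * ENNReal.ofReal √(t - a) := by
        rw [← hnorm]
        gcongr
        exact hbound.trans (by gcongr)
    _ = ENNReal.ofReal (E.C * √(t - a) * ‖f‖) := by
        rw [← ENNReal.ofReal_mul hC, ← ENNReal.ofReal_mul (by positivity)]
        ring_nf

theorem integrableOn_apply (E : CompactEvolutionFamily T X) {a t : ℝ}
    (ha : 0 ≤ a) (htT : t ≤ T) (f : Lp X 2 (volume.restrict (Icc (0:ℝ) T))) :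
    IntegrableOn (fun s => E.U t s (f s)) (Icc a t) := by
  refine memLp_one_iff_integrable.1 ⟨E.aestronglyMeasurable_apply ha htT
    ((Lp.aestronglyMeasurable f).mono_measure
      (Measure.restrict_mono (Icc_subset_Icc ha htT) le_rfl)), ?_⟩
  exact (E.eLpNorm_apply_le ha htT f).trans_lt ENNReal.ofReal_lt_top

theorem norm_setIntegral_apply_le (E : CompactEvolutionFamily T X) {a t : ℝ}
    (ha : 0 ≤ a) (htT : t ≤ T) (f : Lp X 2 (volume.restrict (Icc (0:ℝ) T))) :
    ‖∫ s in Icc a t, E.U t s (f s)‖ ≤ E.C * √(t - a) * ‖f‖ := by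
  have hC : 0 ≤ E.C := zero_le_one.trans E.C_ge_one
  rw [← ENNReal.ofReal_le_ofReal_iff (by positivity), ofReal_norm]
  refine (enorm_integral_le_lintegral_enorm _).trans ?_
  rw [← eLpNorm_one_eq_lintegral_enorm]
  exact E.eLpNorm_apply_le ha htT f

/-- The value at time `t` of the Cauchy operator, as a bounded operator on `L²([0,T];X)`. -/
noncomputable def cauchyAt (E : CompactEvolutionFamily T X) {t : ℝ} (htT : t ≤ T) :
    Lp X 2 (volume.restrict (Icc (0:ℝ) T)) →L[ℝ] X :=
  LinearMap.mkContinuous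
    { toFun := fun f => ∫ s in Icc (0:ℝ) t, E.U t s (f s)
      map_add' := fun f g => by
        rw [← integral_add (E.integrableOn_apply le_rfl htT f) (E.integrableOn_apply le_rfl htT g)]
        refine integral_congr_ae ?_
        filter_upwards [ae_mono (Measure.restrict_mono (Icc_subset_Icc_right htT) le_rfl)
          (Lp.coeFn_add f g)] with s hs
        rw [hs, Pi.add_apply, map_add]
      map_smul' := fun c f => by
        rw [RingHom.id_apply, ← integral_smul]
        refine integral_congr_ae ?_
        filter_upwards [ae_mono (Measure.restrict_mono (Icc_subset_Icc_right htT) le_rfl)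
          (Lp.coeFn_smul c f)] with s hs
        rw [hs, Pi.smul_apply, map_smul] }
    (E.C * √(t - 0)) (E.norm_setIntegral_apply_le le_rfl htT)

theorem cauchyAt_apply (E : CompactEvolutionFamily T X) {t : ℝ} (htT : t ≤ T)
    (f : Lp X 2 (volume.restrict (Icc (0:ℝ) T))) :
    E.cauchyAt htT f = ∫ s in Icc (0:ℝ) t, E.U t s (f s) := rfl

theorem cauchyAt_eq_add [CompleteSpace X] (E : CompactEvolutionFamily T X) {a t : ℝ}
    (ha : 0 ≤ a) (hat : a ≤ t) (htT : t ≤ T) (f : Lp X 2 (volume.restrict (Icc (0:ℝ) T))) :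
    E.cauchyAt htT f =
      E.U t a (E.cauchyAt (hat.trans htT) f) + ∫ s in Icc a t, E.U t s (f s) := by
  rw [cauchyAt_apply, cauchyAt_apply, ← ContinuousLinearMap.integral_comp_comm _
      (E.integrableOn_apply le_rfl (hat.trans htT) f), ← Icc_union_Ioc_eq_Icc ha hat,
    setIntegral_union ((Iic_disjoint_Ioc le_rfl).mono_left Icc_subset_Iic_self)
      measurableSet_Ioc
      ((E.integrableOn_apply le_rfl htT f).mono_set (Icc_subset_Icc_right hat))
      ((E.integrableOn_apply ha htT f).mono_set Ioc_subset_Icc_self),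
    integral_Icc_eq_integral_Ioc (x := a)]
  congr 1
  refine setIntegral_congr_fun measurableSet_Icc fun s hs => ?_
  rw [← E.comp s a t hs.1 hs.2 hat htT]
  rfl

theorem norm_cauchyAt_le [CompleteSpace X] (E : CompactEvolutionFamily T X) {a b t : ℝ}
    (ha : 0 ≤ a) (hab : a ≤ b) (hbt : b ≤ t) (htT : t ≤ T)
    (f : Lp X 2 (volume.restrict (Icc (0:ℝ) T))) :
    ‖E.cauchyAt htT f‖ ≤ E.C * ‖E.U b a (E.cauchyAt (hab.trans (hbt.trans htT)) f)‖ +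
      E.C * √(t - a) * ‖f‖ := by
  rw [E.cauchyAt_eq_add ha (hab.trans hbt) htT, ← E.comp a b t ha hab hbt htT]
  exact (norm_add_le _ _).trans (add_le_add
    ((E.U t b).le_of_opNorm_le (E.norm_bound b t (ha.trans hab) hbt htT) _)
    (E.norm_setIntegral_apply_le ha htT f))

end CompactEvolutionFamily

/-- If `φ_n ⇀ φ` weakly in `L²([0,T];X)`, then the Cauchy integrals
`t ↦ ∫₀ᵗ U(t,s) φ_n(s) ds` converge to `t ↦ ∫₀ᵗ U(t,s) φ(s) ds` uniformly on `[0,T]`,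
i.e. in `C([0,T];X)`: the Cauchy operator of a compact evolution family maps weakly
convergent sequences of `L²([0,T];X)` to norm convergent sequences of `C([0,T];X)`. -/
theorem cauchy_operator_weak_to_uniform
    {X : Type*} [NormedAddCommGroup X] [NormedSpace ℝ X] [CompleteSpace X]
    (T : ℝ) (hT : 0 < T) (E : CompactEvolutionFamily T X)
    (φs : ℕ → Lp X 2 (volume.restrict (Icc (0:ℝ) T)))
    (φ : Lp X 2 (volume.restrict (Icc (0:ℝ) T)))
    (hweak : ∀ F : Lp X 2 (volume.restrict (Icc (0:ℝ) T)) →L[ℝ] ℝ,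
      Tendsto (fun n => F (φs n)) atTop (nhds (F φ))) :
    TendstoUniformlyOn
      (fun n t => ∫ s in Icc (0:ℝ) t, E.U t s (φs n s))
      (fun t => ∫ s in Icc (0:ℝ) t, E.U t s (φ s))
      atTop (Icc (0:ℝ) T) := by
  obtain ⟨M, hM⟩ : ∃ M, ∀ n, ‖φs n - φ‖ ≤ M :=
    exists_norm_le_of_tendsto_dual (x₀ := 0) fun F => by
      simpa using (hweak F).sub_const (F φ)
  have hC : 0 < E.C := zero_lt_one.trans_le E.C_ge_one
  have hdist : ∀ n t (htT : t ≤ T),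
      dist (∫ s in Icc (0:ℝ) t, E.U t s (φ s)) (∫ s in Icc (0:ℝ) t, E.U t s (φs n s)) =
        ‖E.cauchyAt htT (φs n - φ)‖ := fun n t htT => by
    rw [dist_comm, dist_eq_norm, map_sub]
    rfl
  rw [← tendstoLocallyUniformlyOn_iff_tendstoUniformlyOn_of_compact isCompact_Icc,
    Metric.tendstoLocallyUniformlyOn_iff]
  intro ε hε t₀ ht₀
  obtain ⟨η, hη, hsmall⟩ : ∃ η > 0, E.C * √(3 * η) * M < ε / 2 := by
    have hcont : Tendsto (fun η : ℝ => E.C * √(3 * η) * M) (𝓝[>] 0) (𝓝 0) := by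
      have : Continuous fun η : ℝ => E.C * √(3 * η) * M := by fun_prop
      simpa using (this.tendsto 0).mono_left nhdsWithin_le_nhds
    obtain ⟨η, hη, hpos⟩ :=
      ((hcont.eventually_lt_const (half_pos hε)).and self_mem_nhdsWithin).exists
    exact ⟨η, hpos, hη⟩
  have htail : ∀ n (a t : ℝ), t - a ≤ 3 * η → E.C * √(t - a) * ‖φs n - φ‖ < ε / 2 := by
    intro n a t hat
    refine lt_of_le_of_lt ?_ hsmall
    gcongr
    exact hM n
  refine ⟨Ioo (t₀ - η) (t₀ + η) ∩ Icc 0 T,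
    mem_nhdsWithin_iff_exists_mem_nhds_inter.2
      ⟨_, Ioo_mem_nhds (by linarith) (by linarith), subset_rfl⟩, ?_⟩
  rcases lt_or_ge t₀ (2 * η) with hlt | hge
  · refine Eventually.of_forall fun n t ht => ?_
    rw [hdist n t ht.2.2]
    have := E.norm_setIntegral_apply_le le_rfl ht.2.2 (φs n - φ)
    have := htail n 0 t (by linarith [ht.1.2])
    rw [CompactEvolutionFamily.cauchyAt_apply]
    linarith
  · have hcpt : IsCompactOperator ((E.U (t₀ - η) (t₀ - 2 * η)).comp
        (E.cauchyAt (t := t₀ - 2 * η) (by linarith [ht₀.2]))) :=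
      (E.compact (t₀ - 2 * η) (t₀ - η) (by linarith) (by linarith)
        (by linarith [ht₀.2])).comp_clm _
    have hlim := hcpt.tendsto_of_tendsto_dual (x := fun n => φs n - φ) (x₀ := 0) fun F => by
      simpa using (hweak F).sub_const (F φ)
    have hlim' := hlim.norm.const_mul E.C
    rw [map_zero, norm_zero, mul_zero] at hlim'
    filter_upwards [hlim'.eventually_lt_const (half_pos hε)] with n hn t ht
    rw [hdist n t ht.2.2]
    have := E.norm_cauchyAt_le (a := t₀ - 2 * η) (b := t₀ - η) (by linarith) (by linarith)
      ht.1.1.le ht.2.2 (φs n - φ)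
    have := htail n (t₀ - 2 * η) t (by linarith [ht.1.2])
    rw [ContinuousLinearMap.comp_apply] at hn
    linarith
end

section
/- Let U be a compact evolution family on X, let B : H → X be a bounded linear operator, let x₀ ∈ X, and let f : [0,T] × X → X be continuous with ‖f(t,x)‖ ≤ K for all (t,x) ∈ [0,T] × X and some constant K > 0. Let Φ : C([0,T];X) → C([0,T];H) be a continuous map (with respect to the supremum norms) such that ‖Φ(x)(t)‖_H ≤ M₀ for all x ∈ C([0,T];X) and t ∈ [0,T] and some constant M₀ > 0. Then there exists x ∈ C([0,T];X) such that x(t) = U(t,0)x₀ + ∫₀^t U(t,s)( f(s,x(s)) + B(Φ(x)(s)) ) ds for every t ∈ [0,T]; in particular, the non-autonomous semilinear system with the (uniformly bounded, continuous) feedback control u = Φ(x) has at least one mild solution on [0,T]. -/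
open MeasureTheory Set

/-- Extrapolation: the value at `1` of a polynomial of degree at most `n` is a fixed linear
combination of its values at nodes in `(0, δ)`. -/
theorem exists_extrapolation_weights (n : ℕ) {δ : ℝ} (hδ : 0 < δ) :
    ∃ v w : ℕ → ℝ, (∀ i ∈ Finset.range (n + 1), 0 < v i ∧ v i < δ) ∧
      ∀ p : Polynomial ℝ, p.natDegree ≤ n →
        p.eval 1 = ∑ i ∈ Finset.range (n + 1), p.eval (v i) * w i := by
  set v : ℕ → ℝ := fun i => δ * ((i + 1) / (n + 2)) with hv
  have hn : (0 : ℝ) < n + 2 := by positivity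
  have hinj : Set.InjOn v (Finset.range (n + 1)) := by
    intro i _ j _ hij
    simp only [hv] at hij
    have := mul_left_cancel₀ hδ.ne' hij
    rw [div_left_inj' hn.ne'] at this
    exact_mod_cast add_right_cancel this
  refine ⟨v, fun i => (Lagrange.basis (Finset.range (n + 1)) v i).eval 1, fun i hi => ?_,
    fun p hp => ?_⟩
  · have hi' : (i : ℝ) + 1 ≤ n + 1 := by
      exact_mod_cast Finset.mem_range.1 hi
    refine ⟨by positivity, ?_⟩
    have : ((i : ℝ) + 1) / (n + 2) < 1 := by
      rw [div_lt_one hn]; linarith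
    simpa [hv] using mul_lt_mul_of_pos_left this hδ
  · have hdeg : p.degree < (Finset.range (n + 1)).card := by
      rw [Finset.card_range]
      exact (Polynomial.degree_le_of_natDegree_le hp).trans_lt
        (by exact_mod_cast Nat.lt_succ_self n)
    conv_lhs => rw [Lagrange.eq_interpolate hinj hdeg]
    simp [Lagrange.interpolate_apply, Polynomial.eval_finsetSum]

/-- The determinant of `1 + t • A` is a polynomial in `t` of degree at most the dimension. -/
theorem exists_polynomial_eval_eq_det_one_add_smul {E : Type*} [NormedAddCommGroup E]
    [NormedSpace ℝ E] [FiniteDimensional ℝ E] (A : E →L[ℝ] E) :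
    ∃ p : Polynomial ℝ, p.natDegree ≤ Module.finrank ℝ E ∧
      ∀ t : ℝ, p.eval t = (1 + t • A).det := by
  let b := Module.finBasis ℝ E
  let M := LinearMap.toMatrix b b (A : E →ₗ[ℝ] E)
  refine ⟨Matrix.det ((Polynomial.X : Polynomial ℝ) • M.map Polynomial.C +
    (1 : Matrix _ _ ℝ).map Polynomial.C), ?_, fun t => ?_⟩
  · simpa using Polynomial.natDegree_det_X_add_C_le M 1
  · have h1 : (1 + t • A).det = LinearMap.det (1 + t • (A : E →ₗ[ℝ] E)) := rfl
    rw [h1, ← LinearMap.det_toMatrix b, ← Polynomial.coe_evalRingHom, RingHom.map_det]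
    congr 1
    ext i j
    by_cases hij : i = j
    · subst hij
      simp [M, LinearMap.toMatrix_one]
      ring
    · simp [M, LinearMap.toMatrix_one, hij]
      ring

/-- On an interval of small parameters `t`, the operators `1 + t • A` with `‖A‖ ≤ L` have
positive determinant. -/
theorem exists_det_one_add_smul_pos {E : Type*} [NormedAddCommGroup E]
    [NormedSpace ℝ E] [FiniteDimensional ℝ E] (L : ℝ) :
    ∃ δ > 0, ∀ t : ℝ, 0 < t → t < δ → ∀ A : E →L[ℝ] E, ‖A‖ ≤ L → 0 < (1 + t • A).det := by
  have h : ∀ᶠ A : E →L[ℝ] E in nhds 1, 0 < A.det := by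
    refine ContinuousLinearMap.continuous_det.continuousAt.eventually (lt_mem_nhds ?_)
    have : (1 : E →L[ℝ] E).det = 1 := LinearMap.det_id
    simp only [this, one_pos]
  obtain ⟨ε, hε, H⟩ := Metric.eventually_nhds_iff.1 h
  refine ⟨ε / (|L| + 1), by positivity, fun t ht htδ A hA => H ?_⟩
  rw [lt_div_iff₀ (by positivity)] at htδ
  rw [dist_eq_norm, add_sub_cancel_left, norm_smul, Real.norm_of_nonneg ht.le]
  refine lt_of_le_of_lt ?_ htδ
  have := le_abs_self L
  gcongr
  linarith

/-- Extending by zero a Lipschitz map on the unit ball that vanishes on the sphere. -/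
theorem LipschitzOnWith.extend_zero_closedBall {E F : Type*} [NormedAddCommGroup E]
    [NormedSpace ℝ E] [NormedAddCommGroup F] {h : E → F} {L : NNReal}
    (hL : LipschitzOnWith L h (Metric.closedBall 0 1))
    (h0 : ∀ x, 1 ≤ ‖x‖ → h x = 0) : LipschitzWith L h := by
  have key : ∀ x y : E, ‖x‖ ≤ 1 → 1 < ‖y‖ → ‖h x - h y‖ ≤ L * ‖x - y‖ := by
    intro x y hx hy
    have hc : ContinuousOn (fun s : ℝ => ‖x + s • (y - x)‖) (Icc 0 1) := by fun_prop
    obtain ⟨s, hs, hs1⟩ := intermediate_value_Icc zero_le_one hc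
      (show (1 : ℝ) ∈ Icc _ _ by simpa using ⟨hx, hy.le⟩)
    simp only at hs1
    have h1 := hL.norm_sub_le (x := x) (y := x + s • (y - x)) (by simpa using hx)
      (by simp [hs1])
    rw [h0 _ hs1.ge] at h1
    rw [h0 y hy.le]
    refine h1.trans ?_
    gcongr
    rw [show x - (x + s • (y - x)) = s • (x - y) by module, norm_smul,
      Real.norm_of_nonneg hs.1]
    exact mul_le_of_le_one_left (norm_nonneg _) hs.2
  refine LipschitzWith.of_dist_le_mul fun x y => ?_
  rw [dist_eq_norm, dist_eq_norm]
  rcases le_or_gt ‖x‖ 1 with hx | hx <;> rcases le_or_gt ‖y‖ 1 with hy | hy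
  · exact hL.norm_sub_le (by simpa using hx) (by simpa using hy)
  · exact key x y hx hy
  · rw [norm_sub_rev, norm_sub_rev x]; exact key y x hy hx
  · rw [h0 x hx.le, h0 y hy.le]; simp; positivity

/-- A small Lipschitz perturbation of the identity, supported in the unit ball, is injective and
maps the open unit ball onto itself. -/
theorem LipschitzWith.injective_and_image_ball {E : Type*} [NormedAddCommGroup E]
    [NormedSpace ℝ E] [CompleteSpace E] {h : E → E} {L : NNReal}
    (hL : LipschitzWith L h) (h0 : ∀ x, 1 ≤ ‖x‖ → h x = 0) {t : ℝ} (ht : 0 < t)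
    (htL : t * L < 1) :
    Function.Injective (fun x => x + t • h x) ∧
      (fun x => x + t • h x) '' Metric.ball 0 1 = Metric.ball 0 1 := by
  lift t to NNReal using ht.le
  set g := fun x => x + (t : ℝ) • h x with hg
  have happ : ApproximatesLinearOn g
      ((ContinuousLinearEquiv.refl ℝ E : E ≃L[ℝ] E) : E →L[ℝ] E) univ (t * L) := by
    intro x _ y _
    have : g x - g y - (x - y) = (t : ℝ) • (h x - h y) := by simp only [hg]; module
    simp only [ContinuousLinearEquiv.coe_refl, ContinuousLinearMap.id_apply, this, norm_smul,
      Real.norm_of_nonneg ht.le, NNReal.coe_mul, mul_assoc]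
    gcongr
    exact hL.norm_sub_le x y
  have hc : Subsingleton E ∨ (t * L : NNReal) <
      ‖((ContinuousLinearEquiv.refl ℝ E).symm : E →L[ℝ] E)‖₊⁻¹ := by
    rcases subsingleton_or_nontrivial E with hE | hE
    · exact Or.inl hE
    · right
      simp only [ContinuousLinearEquiv.refl_symm, ContinuousLinearEquiv.coe_refl,
        ContinuousLinearMap.nnnorm_id, inv_one]
      exact_mod_cast htL
  have hinj : Function.Injective g := by
    simpa [Set.injOn_univ] using happ.injOn hc
  have hsurj : Function.Surjective g := happ.surjective hc
  have hid : ∀ x, 1 ≤ ‖x‖ → g x = x := fun x hx => by simp [hg, h0 x hx]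
  refine ⟨hinj, Subset.antisymm ?_ fun y hy => ?_⟩
  · rintro _ ⟨x, hx, rfl⟩
    by_contra hgx
    simp only [mem_ball_zero_iff, not_lt] at hx hgx
    rw [hinj (hid _ hgx)] at hgx
    linarith
  · obtain ⟨x, rfl⟩ := hsurj y
    refine ⟨x, ?_, rfl⟩
    by_contra hx
    simp only [mem_ball_zero_iff, not_lt] at hx hy
    rw [hid x hx] at hy
    linarith

/-- If `r` maps a neighbourhood of `x` into the unit sphere, its derivative at `x` is singular. -/
theorem HasFDerivAt.det_eq_zero_of_norm_eq_one {E : Type*} [NormedAddCommGroup E]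
    [InnerProductSpace ℝ E] [FiniteDimensional ℝ E] {r : E → E} {r' : E →L[ℝ] E} {x : E}
    (hr : HasFDerivAt r r' x) (h1 : ∀ᶠ y in nhds x, ‖r y‖ = 1) : r'.det = 0 := by
  have hd := hr.norm_sq
  have hz : HasFDerivAt (fun y => ‖r y‖ ^ 2) (0 : E →L[ℝ] ℝ) x :=
    (hasFDerivAt_const (1 : ℝ) x).congr_of_eventuallyEq (h1.mono fun y hy => by simp [hy])
  have heq := hd.unique hz
  by_contra hdet
  have hbij : IsUnit (LinearMap.det (r' : E →ₗ[ℝ] E)) := isUnit_iff_ne_zero.2 hdet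
  obtain ⟨v, hv⟩ := (LinearMap.isUnit_iff_range_eq_top _).1
    ((LinearMap.isUnit_iff_isUnit_det _).2 hbij) |> LinearMap.range_eq_top.1 <| r x
  have h2 := DFunLike.congr_fun heq v
  have hv' : r' v = r x := hv
  simp [hv', h1.self_of_nhds] at h2

/-- There is no `C¹` retraction of the closed unit ball onto the unit sphere. -/
theorem not_exists_contDiff_retraction_sphere {E : Type*} [NormedAddCommGroup E]
    [InnerProductSpace ℝ E] [FiniteDimensional ℝ E] {r : E → E}
    (hr : ∀ x ∈ Metric.closedBall (0 : E) 1, ContDiffAt ℝ 1 r x)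
    (h1 : ∀ x ∈ Metric.closedBall (0 : E) 1, ‖r x‖ = 1)
    (h2 : ∀ x : E, ‖x‖ = 1 → r x = x) : False := by
  classical
  let : MeasurableSpace E := borel E
  have : BorelSpace E := ⟨rfl⟩
  have hK : IsCompact (Metric.closedBall (0 : E) 1) := isCompact_closedBall _ _
  have hdc : ContinuousOn (fun x => fderiv ℝ r x - 1) (Metric.closedBall 0 1) := fun x hx =>
    (((hr x hx).fderiv_right (m := 0) le_rfl).continuousAt.sub
      continuousAt_const).continuousWithinAt
  have hdiff : ∀ x ∈ Metric.closedBall (0 : E) 1,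
      HasFDerivAt (fun x => r x - x) (fderiv ℝ r x - 1) x := fun x hx =>
    ((hr x hx).differentiableAt one_ne_zero).hasFDerivAt.sub (hasFDerivAt_id x)
  obtain ⟨L, hLb⟩ := hK.exists_bound_of_continuousOn hdc
  have hL0 : 0 ≤ L := (norm_nonneg _).trans (hLb 0 (by simp))
  lift L to NNReal using hL0
  set h : E → E := fun x => if ‖x‖ < 1 then r x - x else 0 with hh
  have hheq : ∀ x ∈ Metric.closedBall (0 : E) 1, h x = r x - x := by
    intro x hx
    rcases (mem_closedBall_zero_iff.1 hx).lt_or_eq with hlt | heq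
    · simp [hh, hlt]
    · simp [hh, heq, h2 x heq]
  have h0 : ∀ x, 1 ≤ ‖x‖ → h x = 0 := fun x hx => by simp [hh, not_lt.2 hx]
  have hlip : LipschitzWith L h := by
    refine LipschitzOnWith.extend_zero_closedBall ?_ h0
    have hLip : LipschitzOnWith L (fun x => r x - x) (Metric.closedBall 0 1) :=
      (convex_closedBall (0 : E) 1).lipschitzOnWith_of_nnnorm_hasFDerivWithin_le
        (fun x hx => (hdiff x hx).hasFDerivWithinAt) fun x hx => by exact_mod_cast hLb x hx
    intro x hx y hy
    rw [hheq x hx, hheq y hy]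
    exact hLip hx hy
  obtain ⟨δ, hδ, hpos⟩ := exists_det_one_add_smul_pos (E := E) L
  obtain ⟨v, w, hv, hw⟩ := exists_extrapolation_weights (Module.finrank ℝ E)
    (lt_min hδ (show (0 : ℝ) < 1 / (L + 1) by positivity))
  have hsub : Metric.ball (0 : E) 1 ⊆ Metric.closedBall 0 1 := Metric.ball_subset_closedBall
  have hint : ∀ t : ℝ, IntegrableOn (fun x => (1 + t • (fderiv ℝ r x - 1)).det)
      (Metric.ball (0 : E) 1) := fun t =>
    (ContinuousOn.integrableOn_compact hK
      (ContinuousLinearMap.continuous_det.comp_continuousOn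
        (continuousOn_const.add (hdc.const_smul t)))).mono_set hsub
  have hvol : ∀ t : ℝ, 0 < t → t < min δ (1 / (L + 1)) →
      ∫ x in Metric.ball (0 : E) 1, (1 + t • (fderiv ℝ r x - 1)).det =
        ∫ _ in Metric.ball (0 : E) 1, (1 : ℝ) := by
    intro t ht htm
    have htL : t * L < 1 := by
      have := htm.trans_le (min_le_right _ _)
      rw [lt_div_iff₀ (by positivity)] at this
      nlinarith
    obtain ⟨hinj, himg⟩ := hlip.injective_and_image_ball h0 ht htL
    have hder : ∀ x ∈ Metric.ball (0 : E) 1, HasFDerivWithinAt (fun x => x + t • h x)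
        (1 + t • (fderiv ℝ r x - 1)) (Metric.ball 0 1) x := by
      intro x hx
      have hx' : HasFDerivAt (fun x => x + t • (r x - x)) (1 + t • (fderiv ℝ r x - 1)) x :=
        (hasFDerivAt_id x).add ((hdiff x (hsub hx)).const_smul t)
      exact hx'.hasFDerivWithinAt.congr (fun y hy => by rw [hheq y (hsub hy)])
        (by rw [hheq x (hsub hx)])
    have := integral_image_eq_integral_abs_det_fderiv_smul volume measurableSet_ball hder
      hinj.injOn (fun _ => (1 : ℝ))
    rw [himg] at this
    rw [this]
    refine setIntegral_congr_fun measurableSet_ball fun x hx => ?_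
    have hp := hpos t ht (htm.trans_le (min_le_left _ _)) _ (hLb x (hsub hx))
    simp [abs_of_pos hp]
  have hzero : ∫ x in Metric.ball (0 : E) 1, (1 + (1 : ℝ) • (fderiv ℝ r x - 1)).det = 0 := by
    rw [setIntegral_congr_fun (g := fun _ => (0 : ℝ)) measurableSet_ball, integral_zero]
    intro x hx
    have hrx := ((hr x (hsub hx)).differentiableAt one_ne_zero).hasFDerivAt
    have hdet := hrx.det_eq_zero_of_norm_eq_one
      (Filter.mem_of_superset (Metric.isOpen_ball.mem_nhds hx) fun y hy => h1 y (hsub hy))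
    simpa using hdet
  have hone : ∫ x in Metric.ball (0 : E) 1, (1 + (1 : ℝ) • (fderiv ℝ r x - 1)).det =
      ∫ _ in Metric.ball (0 : E) 1, (1 : ℝ) := by
    have hexp : ∀ x : E, (1 + (1 : ℝ) • (fderiv ℝ r x - 1)).det =
        ∑ i ∈ Finset.range (Module.finrank ℝ E + 1),
          (1 + v i • (fderiv ℝ r x - 1)).det * w i := by
      intro x
      obtain ⟨p, hp, hpe⟩ := exists_polynomial_eval_eq_det_one_add_smul (fderiv ℝ r x - 1)
      simpa only [hpe] using hw p hp
    have hsum := hw 1 (by simp)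
    simp only [Polynomial.eval_one, one_mul] at hsum
    simp_rw [hexp]
    rw [integral_finsetSum _ fun i _ => (hint (v i)).mul_const (w i)]
    simp_rw [integral_mul_const]
    rw [Finset.sum_congr rfl fun i hi => by rw [hvol (v i) (hv i hi).1 (hv i hi).2],
      ← Finset.mul_sum, ← hsum, mul_one]
  rw [hzero] at hone
  have hball : 0 < volume.real (Metric.ball (0 : E) 1) :=
    ENNReal.toReal_pos (Metric.measure_ball_pos _ _ one_pos).ne' measure_ball_lt_top.ne
  simp at hone
  exact hball.ne hone

/-- A `C¹` map of a Euclidean space into its closed unit ball has a fixed point. -/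
theorem exists_fixedPoint_of_contDiff {E : Type*} [NormedAddCommGroup E]
    [InnerProductSpace ℝ E] [FiniteDimensional ℝ E] {f : E → E} (hf : ContDiff ℝ 1 f)
    (hb : ∀ x, ‖f x‖ ≤ 1) : ∃ x, f x = x := by
  by_contra! hne
  set a : E → ℝ := fun x => ‖x - f x‖ ^ 2 with ha
  set b : E → ℝ := fun x => inner ℝ x (x - f x) with hb'
  set c : E → ℝ := fun x => ‖x‖ ^ 2 - 1 with hc
  have hapos : ∀ x, 0 < a x := fun x => by
    have : 0 < ‖x - f x‖ := norm_pos_iff.2 (sub_ne_zero.2 (hne x).symm)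
    positivity
  have hab : ∀ x, 2 * b x = ‖x‖ ^ 2 + a x - ‖f x‖ ^ 2 := fun x => by
    simp only [ha, hb', norm_sub_sq_real, inner_sub_right, real_inner_self_eq_norm_sq]
    ring
  have hbpos : ∀ x, ‖x‖ = 1 → 0 < b x := fun x hx => by
    have h1 := hab x
    have h2 : ‖f x‖ ^ 2 ≤ 1 := pow_le_one₀ (norm_nonneg _) (hb x)
    rw [hx] at h1
    linarith [hapos x]
  have hdisc : ∀ x ∈ Metric.closedBall (0 : E) 1, 0 < b x ^ 2 - a x * c x := by
    intro x hx
    rcases (mem_closedBall_zero_iff.1 hx).lt_or_eq with hlt | heq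
    · have : c x < 0 := sub_neg.2 (pow_lt_one₀ (norm_nonneg _) hlt two_ne_zero)
      nlinarith [mul_neg_of_pos_of_neg (hapos x) this, sq_nonneg (b x)]
    · have : c x = 0 := by simp [hc, heq]
      rw [this]
      have := hbpos x heq
      simpa using pow_pos this 2
  set l : E → ℝ := fun x => (-b x + √(b x ^ 2 - a x * c x)) / a x with hl
  have hsub : ContDiff ℝ 1 fun x => x - f x := contDiff_id.sub hf
  have had : ContDiff ℝ 1 a := hsub.norm_sq ℝ
  have hbd : ContDiff ℝ 1 b := contDiff_id.inner ℝ hsub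
  have hcd : ContDiff ℝ 1 c := (contDiff_id.norm_sq ℝ).sub contDiff_const
  refine not_exists_contDiff_retraction_sphere (r := fun x => x + l x • (x - f x)) ?_ ?_ ?_
  · intro x hx
    have hs : ContDiffAt ℝ 1 (fun x => √(b x ^ 2 - a x * c x)) x :=
      ((hbd.pow 2).sub (had.mul hcd)).contDiffAt.sqrt (hdisc x hx).ne'
    exact contDiffAt_id.add
      (((hbd.contDiffAt.neg.add hs).div had.contDiffAt (hapos x).ne').smul hsub.contDiffAt)
  · intro x hx
    have hroot : a x * l x ^ 2 + 2 * b x * l x + c x = 0 := by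
      have hs := Real.sq_sqrt (hdisc x hx).le
      have ha0 := (hapos x).ne'
      simp only [hl]
      field_simp
      linear_combination hs
    have hsq : ‖x + l x • (x - f x)‖ ^ 2 = 1 := by
      rw [norm_add_sq_real, inner_smul_right, norm_smul, mul_pow, Real.norm_eq_abs, sq_abs]
      simp only [ha, hb', hc] at hroot
      linear_combination hroot
    exact (pow_eq_one_iff_of_nonneg (norm_nonneg _) two_ne_zero).1 hsq
  · intro x hx
    have hcx : c x = 0 := by simp [hc, hx]
    simp [hl, hcx, Real.sqrt_sq (hbpos x hx).le]

/-- **Brouwer's fixed point theorem** for continuous self-maps with values in the unit ball. -/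
theorem exists_fixedPoint_of_norm_le_one {E : Type*} [NormedAddCommGroup E]
    [InnerProductSpace ℝ E] [FiniteDimensional ℝ E] {f : E → E} (hf : Continuous f)
    (hb : ∀ x, ‖f x‖ ≤ 1) : ∃ x, f x = x := by
  by_contra! hne
  obtain ⟨x₀, -, hx₀⟩ := (isCompact_closedBall (0 : E) 1).exists_isMinOn
    ⟨0, by simp⟩ (f := fun x => ‖f x - x‖) (by fun_prop)
  have hε : 0 < ‖f x₀ - x₀‖ := norm_pos_iff.2 (sub_ne_zero.2 (hne x₀))
  obtain ⟨g, hg⟩ := exists_contMDiffMap_forall_mem_convex_of_local_const (n := 1)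
    (modelWithCornersSelf ℝ E)
    (t := fun x => Metric.ball (f x) ‖f x₀ - x₀‖ ∩ Metric.closedBall 0 1)
    (fun x => (convex_ball _ _).inter (convex_closedBall _ _))
    (fun x => ⟨f x, by
      filter_upwards [hf.continuousAt.eventually (Metric.ball_mem_nhds (f x) hε)] with y hy
      exact ⟨Metric.mem_ball_comm.1 hy, by simpa using hb x⟩⟩)
  obtain ⟨x, hx⟩ := exists_fixedPoint_of_contDiff g.contMDiff.contDiff
    fun x => by simpa using (hg x).2
  have h1 := (hg x).1
  have h2 : ‖f x₀ - x₀‖ ≤ ‖f x - x‖ := hx₀ (show x ∈ _ by simpa [hx] using (hg x).2)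
  rw [hx, Metric.mem_ball, dist_comm, dist_eq_norm] at h1
  linarith

/-- **Schauder's fixed point theorem** for a continuous self-map of a normed space with range in
a compact set. -/
theorem exists_fixedPoint_of_mem_compact {Y : Type*} [NormedAddCommGroup Y] [NormedSpace ℝ Y]
    {G : Y → Y} (hG : Continuous G) {K : Set Y} (hK : IsCompact K) (hGK : ∀ y, G y ∈ K) :
    ∃ y, G y = y := by
  have happrox : ∀ ε > 0, ∃ y, ‖G y - y‖ ≤ ε := by
    intro ε hε
    obtain ⟨s, hsK, hcov⟩ := hK.elim_nhds_subcover (fun y => Metric.ball y ε)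
      fun y _ => Metric.ball_mem_nhds y hε
    set m : s → Y → ℝ := fun i y => max 0 (ε - ‖y - i‖) with hm
    set S : Y → ℝ := fun y => ∑ i, m i y with hS
    have hm0 : ∀ i y, 0 ≤ m i y := fun i y => le_max_left _ _
    have hSpos : ∀ y, 0 < S (G y) := by
      intro y
      obtain ⟨i, his, hi⟩ := mem_iUnion₂.1 (hcov (hGK y))
      refine Finset.sum_pos' (fun i _ => hm0 i _) ⟨⟨i, his⟩, Finset.mem_univ _, ?_⟩
      rw [Metric.mem_ball, dist_eq_norm] at hi
      exact lt_max_of_lt_right (by linarith)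
    set P : EuclideanSpace ℝ s → Y := fun c => ∑ i, c i • (i : Y) with hP
    have hPc : Continuous P := by fun_prop
    set W : EuclideanSpace ℝ s → EuclideanSpace ℝ s := fun c =>
      WithLp.toLp 2 fun i => m i (G (P c)) / S (G (P c)) with hW
    have hWc : Continuous W := by
      refine (PiLp.continuous_toLp 2 _).comp (continuous_pi fun i => ?_)
      refine Continuous.div ?_ ?_ fun c => (hSpos _).ne'
      · fun_prop
      · fun_prop
    have hW0 : ∀ c i, 0 ≤ W c i := fun c i => div_nonneg (hm0 _ _) (hSpos _).le
    have hW1 : ∀ c, ∑ i, W c i = 1 := fun c => by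
      simp only [hW, ← Finset.sum_div]
      exact div_self (hSpos _).ne'
    have hWb : ∀ c, ‖W c‖ ≤ 1 := by
      intro c
      rw [EuclideanSpace.norm_eq, Real.sqrt_le_iff, one_pow, ← hW1 c]
      refine ⟨(hW1 c).symm ▸ zero_le_one, ?_⟩
      refine Finset.sum_le_sum fun i _ => ?_
      rw [Real.norm_of_nonneg (hW0 c i), sq]
      exact mul_le_of_le_one_left (hW0 c i)
        ((Finset.single_le_sum (fun j _ => hW0 c j) (Finset.mem_univ i)).trans_eq (hW1 c))
    obtain ⟨c, hc⟩ := exists_fixedPoint_of_norm_le_one hWc hWb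
    refine ⟨P c, ?_⟩
    have hdecomp : G (P c) - P c = ∑ i, W c i • (G (P c) - (i : Y)) := by
      simp only [smul_sub, Finset.sum_sub_distrib, ← Finset.sum_smul, hW1, one_smul]
      rw [hc]
    rw [hdecomp]
    calc ‖∑ i, W c i • (G (P c) - (i : Y))‖ ≤ ∑ i, W c i * ε := by
          refine norm_sum_le_of_le _ fun i _ => ?_
          rw [norm_smul, Real.norm_of_nonneg (hW0 c i)]
          rcases le_or_gt ‖G (P c) - i‖ ε with h | h
          · exact mul_le_mul_of_nonneg_left h (hW0 c i)
          · have : W c i = 0 := by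
              simp [hW, hm, max_eq_left (sub_nonpos.2 h.le)]
            simp [this]
      _ = ε := by rw [← Finset.sum_mul, hW1, one_mul]
  choose y hy using fun n : ℕ => happrox (1 / ((n : ℝ) + 1)) (by positivity)
  obtain ⟨z, -, φ, hφ, hz⟩ := hK.tendsto_subseq fun n => hGK (y n)
  have hdiff : Filter.Tendsto (fun n => G (y (φ n)) - y (φ n)) Filter.atTop (nhds 0) :=
    squeeze_zero_norm (fun n => hy (φ n))
      (tendsto_one_div_add_atTop_nhds_zero_nat.comp hφ.tendsto_atTop)
  have hyz : Filter.Tendsto (fun n => y (φ n)) Filter.atTop (nhds z) := by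
    simpa using hz.sub hdiff
  exact ⟨z, tendsto_nhds_unique ((hG.tendsto z).comp hyz) hz⟩

/-- Strong continuity and a uniform bound make `(A, x) ↦ A x` continuous along `s ↦ (A s, g s)`. -/
theorem ContinuousOn.clm_apply_of_strong {S X Y : Type*} [TopologicalSpace S]
    [NormedAddCommGroup X] [NormedSpace ℝ X] [NormedAddCommGroup Y] [NormedSpace ℝ Y]
    {A : S → X →L[ℝ] Y} {g : S → X} {D : Set S} {C : ℝ}
    (hA : ∀ x, ContinuousOn (fun s => A s x) D) (hC : ∀ s ∈ D, ‖A s‖ ≤ C)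
    (hg : ContinuousOn g D) : ContinuousOn (fun s => A s (g s)) D := by
  intro s₀ hs₀
  have h1 : Filter.Tendsto (fun s => A s (g s - g s₀)) (nhdsWithin s₀ D) (nhds 0) := by
    have hlim : Filter.Tendsto (fun s => C * ‖g s - g s₀‖) (nhdsWithin s₀ D) (nhds 0) := by
      have := ((hg s₀ hs₀).sub (continuousWithinAt_const (b := g s₀))).norm.const_mul C
      simpa [ContinuousWithinAt] using this
    refine squeeze_zero_norm' ?_ hlim
    filter_upwards [self_mem_nhdsWithin] with s hs
    exact (A s).le_of_opNorm_le (hC s hs) _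
  have h2 := h1.add (hA (g s₀) s₀ hs₀)
  simpa [ContinuousWithinAt] using h2

/-- Strong continuity of a bounded family of operators is uniform on totally bounded sets. -/
theorem TotallyBounded.eventually_norm_clm_sub_lt {S X Y : Type*} [TopologicalSpace S]
    [NormedAddCommGroup X] [NormedSpace ℝ X] [NormedAddCommGroup Y] [NormedSpace ℝ Y]
    {A : S → X →L[ℝ] Y} {D : Set S} {C : ℝ} {Q : Set X} (hQ : TotallyBounded Q)
    (hA : ∀ x, ContinuousOn (fun s => A s x) D) (hC : ∀ s ∈ D, ‖A s‖ ≤ C)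
    {s₀ : S} (hs₀ : s₀ ∈ D) {ε : ℝ} (hε : 0 < ε) :
    ∀ᶠ s in nhdsWithin s₀ D, ∀ x ∈ Q, ‖A s x - A s₀ x‖ < ε := by
  have hC0 : 0 ≤ C := (norm_nonneg _).trans (hC s₀ hs₀)
  set η := ε / (3 * (C + 1)) with hη
  have hη0 : 0 < η := by positivity
  have hCη : C * η < ε / 3 := by
    rw [hη, mul_div_assoc', div_lt_div_iff₀ (by positivity) (by positivity)]
    nlinarith
  obtain ⟨F, hF, hcov⟩ := Metric.totallyBounded_iff.1 hQ η hη0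
  have hev : ∀ᶠ s in nhdsWithin s₀ D, ∀ y ∈ F, ‖A s y - A s₀ y‖ < ε / 3 := by
    rw [Filter.eventually_all_finite hF]
    intro y _
    have := (hA y s₀ hs₀).eventually (Metric.ball_mem_nhds _ (show 0 < ε / 3 by positivity))
    simpa only [Metric.mem_ball, dist_eq_norm] using this
  filter_upwards [hev, self_mem_nhdsWithin] with s hs hsD x hx
  obtain ⟨y, hyF, hxy⟩ := mem_iUnion₂.1 (hcov hx)
  rw [Metric.mem_ball, dist_eq_norm] at hxy
  have h1 : ‖A s (x - y)‖ ≤ C * η := (A s).le_of_opNorm_le_of_le (hC s hsD) hxy.le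
  have h2 : ‖A s₀ (x - y)‖ ≤ C * η := (A s₀).le_of_opNorm_le_of_le (hC s₀ hs₀) hxy.le
  have heq : A s x - A s₀ x = A s (x - y) + (A s y - A s₀ y) - A s₀ (x - y) := by
    simp only [map_sub]; abel
  rw [heq]
  have h3 := norm_sub_le (A s (x - y) + (A s y - A s₀ y)) (A s₀ (x - y))
  have h4 := norm_add_le (A s (x - y)) (A s y - A s₀ y)
  linarith [hs y hyF]

/-- A set approximable by totally bounded sets is totally bounded. -/
theorem totallyBounded_of_forall_exists_dist_le {X : Type*} [PseudoMetricSpace X] {S : Set X}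
    (h : ∀ ε > 0, ∃ Q : Set X, TotallyBounded Q ∧ ∀ x ∈ S, ∃ y ∈ Q, dist x y ≤ ε) :
    TotallyBounded S := by
  refine Metric.totallyBounded_iff.2 fun ε hε => ?_
  obtain ⟨Q, hQ, hSQ⟩ := h (ε / 2) (by positivity)
  obtain ⟨F, hF, hcov⟩ := Metric.totallyBounded_iff.1 hQ (ε / 2) (by positivity)
  refine ⟨F, hF, fun x hx => ?_⟩
  obtain ⟨y, hy, hxy⟩ := hSQ x hx
  obtain ⟨z, hz, hyz⟩ := mem_iUnion₂.1 (hcov hy)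
  refine mem_iUnion₂.2 ⟨z, hz, ?_⟩
  rw [Metric.mem_ball] at hyz ⊢
  linarith [dist_triangle x y z]

/-- **Arzelà–Ascoli**: an equicontinuous, pointwise totally bounded family of continuous functions
on a compact space is relatively compact. -/
theorem isCompact_closure_of_equicontinuous {Z X : Type*} [TopologicalSpace Z] [CompactSpace Z]
    [NormedAddCommGroup X] [CompleteSpace X] {S : Set C(Z, X)}
    (heq : Equicontinuous fun (F : S) z => (F : C(Z, X)) z)
    (htb : ∀ z, TotallyBounded ((fun F : C(Z, X) => F z) '' S)) : IsCompact (closure S) := by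
  refine ArzelaAscoli.isCompact_closure_of_isClosedEmbedding (𝔖 := {K : Set Z | IsCompact K})
    (F := fun (F : C(Z, X)) z => F z) (fun K hK => hK) ?_ (fun K _ => heq.equicontinuousOn K)
    fun K _ z _ => ⟨closure ((fun F : C(Z, X) => F z) '' S), ?_, fun F hF => ?_⟩
  · have : T2Space (UniformOnFun Z X {K : Set Z | IsCompact K}) :=
      UniformOnFun.t2Space_of_covering
        (eq_univ_of_forall fun z => mem_sUnion_of_mem (mem_singleton z) isCompact_singleton)
    exact ContinuousMap.isUniformEmbedding_toUniformOnFunIsCompact.isClosedEmbedding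
  · exact isCompact_iff_totallyBounded_isComplete.2
      ⟨(htb z).closure, isClosed_closure.isComplete⟩
  · exact subset_closure ⟨F, hF, rfl⟩

namespace CompactEvolutionFamily

variable {T : ℝ} {X : Type*} [NormedAddCommGroup X] [NormedSpace ℝ X]

/-- The mild solution operator `F ↦ ∫₀ᵗ U(t,s) F(s) ds`. -/
noncomputable def duhamel (E : CompactEvolutionFamily T X) (hT : 0 ≤ T) (F : C(Icc (0 : ℝ) T, X))
    (t : ℝ) : X :=
  ∫ s in Icc (0 : ℝ) t, E.U t s (IccExtend hT F s)

theorem C_nonneg (E : CompactEvolutionFamily T X) : 0 ≤ E.C := zero_le_one.trans E.C_ge_one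

theorem continuousOn_left (E : CompactEvolutionFamily T X) {s : ℝ} (hs : 0 ≤ s) (x : X) :
    ContinuousOn (fun t => E.U t s x) (Icc s T) :=
  (E.strong_cont x).comp (by fun_prop : ContinuousOn (fun t : ℝ => (t, s)) (Icc s T))
    fun _ ht => ⟨hs, ht.1, ht.2⟩

theorem continuousOn_right (E : CompactEvolutionFamily T X) {t : ℝ} (ht : t ≤ T) (x : X) :
    ContinuousOn (fun s => E.U t s x) (Icc 0 t) :=
  (E.strong_cont x).comp (by fun_prop : ContinuousOn (fun s : ℝ => (t, s)) (Icc 0 t))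
    fun _ hs => ⟨hs.1, hs.2, ht⟩

theorem integrableOn_duhamel (E : CompactEvolutionFamily T X) (hT : 0 ≤ T)
    (F : C(Icc (0 : ℝ) T, X)) {t : ℝ} (ht : t ≤ T) :
    IntegrableOn (fun s => E.U t s (IccExtend hT F s)) (Icc 0 t) :=
  (ContinuousOn.clm_apply_of_strong (E.continuousOn_right ht)
    (fun s hs => E.norm_bound s t hs.1 hs.2 ht)
    (F.continuous.Icc_extend' (h := hT)).continuousOn).integrableOn_Icc

theorem duhamel_sub (E : CompactEvolutionFamily T X) (hT : 0 ≤ T) (F F' : C(Icc (0 : ℝ) T, X))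
    {t : ℝ} (ht : t ≤ T) :
    E.duhamel hT F t - E.duhamel hT F' t = E.duhamel hT (F - F') t := by
  rw [duhamel, duhamel, duhamel,
    ← integral_sub (E.integrableOn_duhamel hT F ht) (E.integrableOn_duhamel hT F' ht)]
  simp [IccExtend]

theorem duhamel_zero (E : CompactEvolutionFamily T X) (hT : 0 ≤ T) (F : C(Icc (0 : ℝ) T, X)) :
    E.duhamel hT F 0 = 0 := by
  simp [duhamel]

variable [CompleteSpace X]

theorem norm_duhamel_sub_apply_le (E : CompactEvolutionFamily T X) (hT : 0 ≤ T)
    {F : C(Icc (0 : ℝ) T, X)} {M : ℝ} (hF : ‖F‖ ≤ M) {r t : ℝ} (hr : 0 ≤ r) (hrt : r ≤ t)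
    (ht : t ≤ T) :
    ‖E.duhamel hT F t - E.U t r (E.duhamel hT F r)‖ ≤ E.C * M * (t - r) := by
  have hint := E.integrableOn_duhamel hT F ht
  have hsplit : E.duhamel hT F t = (∫ s in Icc (0 : ℝ) r, E.U t s (IccExtend hT F s)) +
      ∫ s in Ioc r t, E.U t s (IccExtend hT F s) := by
    rw [duhamel, ← Icc_union_Ioc_eq_Icc hr hrt]
    refine setIntegral_union ?_ measurableSet_Ioc
      (hint.mono_set (Icc_subset_Icc_right hrt))
      (hint.mono_set ((Ioc_subset_Icc_self).trans (Icc_subset_Icc_left hr)))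
    exact Set.disjoint_left.2 fun s h1 h2 => not_lt.2 h1.2 h2.1
  have hcomp : E.U t r (E.duhamel hT F r) =
      ∫ s in Icc (0 : ℝ) r, E.U t s (IccExtend hT F s) := by
    rw [duhamel, ← ContinuousLinearMap.integral_comp_comm _
      (E.integrableOn_duhamel hT F (hrt.trans ht))]
    refine setIntegral_congr_fun measurableSet_Icc fun s hs => ?_
    simp only [← E.comp s r t hs.1 hs.2 hrt ht, ContinuousLinearMap.comp_apply]
  rw [hsplit, hcomp, add_sub_cancel_left]
  have := norm_setIntegral_le_of_norm_le_const (μ := volume) (s := Ioc r t)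
    (f := fun s => E.U t s (IccExtend hT F s)) (C := E.C * M) measure_Ioc_lt_top
    fun s hs => (E.U t s).le_of_opNorm_le_of_le (E.norm_bound s t (hr.trans hs.1.le) hs.2 ht)
      ((F.norm_coe_le_norm _).trans hF)
  simpa [measureReal_def, Real.volume_Ioc, hrt] using this

theorem norm_duhamel_le (E : CompactEvolutionFamily T X) (hT : 0 ≤ T)
    {F : C(Icc (0 : ℝ) T, X)} {M : ℝ} (hF : ‖F‖ ≤ M) {t : ℝ} (ht0 : 0 ≤ t) (ht : t ≤ T) :
    ‖E.duhamel hT F t‖ ≤ E.C * M * T := by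
  have hM : 0 ≤ M := (norm_nonneg _).trans hF
  have hC := E.C_nonneg
  have := E.norm_duhamel_sub_apply_le hT hF le_rfl ht0 ht
  rw [duhamel_zero, map_zero, sub_zero, sub_zero] at this
  exact this.trans (by gcongr)

theorem totallyBounded_duhamel (E : CompactEvolutionFamily T X) (hT : 0 ≤ T) {M : ℝ}
    (hM : 0 ≤ M) {t : ℝ} (ht0 : 0 ≤ t) (ht : t ≤ T) :
    TotallyBounded ((fun F => E.duhamel hT F t) '' Metric.closedBall 0 M) := by
  have hC := E.C_nonneg
  rcases ht0.eq_or_lt with rfl | htpos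
  · refine (finite_singleton (0 : X)).totallyBounded.subset ?_
    rintro _ ⟨F, -, rfl⟩
    exact E.duhamel_zero hT F
  refine totallyBounded_of_forall_exists_dist_le fun ε hε => ?_
  obtain ⟨r, hr0, hrt, hrε⟩ : ∃ r, 0 ≤ r ∧ r < t ∧ E.C * M * (t - r) ≤ ε := by
    refine ⟨max 0 (t - ε / (E.C * M + 1)), le_max_left _ _,
      max_lt htpos (sub_lt_self _ (by positivity)), ?_⟩
    have h1 : t - max 0 (t - ε / (E.C * M + 1)) ≤ ε / (E.C * M + 1) := by
      linarith [le_max_right 0 (t - ε / (E.C * M + 1))]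
    calc E.C * M * (t - max 0 (t - ε / (E.C * M + 1)))
        ≤ (E.C * M + 1) * (ε / (E.C * M + 1)) :=
          mul_le_mul (by linarith) h1 (sub_nonneg.2 (max_le ht0 (sub_le_self _ (by positivity))))
            (by positivity)
      _ = ε := by field_simp
  refine ⟨E.U t r '' Metric.closedBall 0 (E.C * M * T), ?_, ?_⟩
  · exact ((E.compact r t hr0 hrt ht).isCompact_closure_image_closedBall _).totallyBounded.subset
      subset_closure
  · rintro _ ⟨F, hF, rfl⟩
    have hF' : ‖F‖ ≤ M := by simpa using hF
    refine ⟨_, ⟨E.duhamel hT F r, ?_, rfl⟩, ?_⟩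
    · simpa using E.norm_duhamel_le hT hF' hr0 (hrt.le.trans ht)
    · rw [dist_eq_norm]
      exact (E.norm_duhamel_sub_apply_le hT hF' hr0 hrt.le ht).trans hrε

theorem eventually_norm_duhamel_sub_lt (E : CompactEvolutionFamily T X) (hT : 0 ≤ T) {M : ℝ}
    (hM : 0 ≤ M) {t : ℝ} (ht0 : 0 ≤ t) (ht : t ≤ T) {ε : ℝ} (hε : 0 < ε) :
    ∀ᶠ t' in nhdsWithin t (Icc 0 T), ∀ F ∈ Metric.closedBall (0 : C(Icc (0 : ℝ) T, X)) M,
      ‖E.duhamel hT F t' - E.duhamel hT F t‖ < ε := by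
  have hC := E.C_nonneg
  set η := ε / (6 * (E.C * M + 1)) with hη
  have hη0 : 0 < η := by positivity
  have hCη : E.C * M * η ≤ ε / 6 := by
    rw [hη, mul_div_assoc', div_le_div_iff₀ (by positivity) (by positivity)]
    nlinarith
  set r := max 0 (t - η) with hr
  have hr0 : 0 ≤ r := le_max_left _ _
  have hrt : r ≤ t := max_le ht0 (by linarith)
  have htr : t - r ≤ η := by linarith [le_max_right 0 (t - η)]
  have hmem : ∀ᶠ t' in nhdsWithin t (Icc 0 T), t' ∈ Icc r T := by
    filter_upwards [self_mem_nhdsWithin,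
      mem_nhdsWithin_of_mem_nhds (Ioi_mem_nhds (show t - η < t by linarith))] with t' h1 h2
    exact ⟨max_le h1.1 (le_of_lt h2), h1.2⟩
  have hev := (E.totallyBounded_duhamel hT hM hr0 (hrt.trans ht)).eventually_norm_clm_sub_lt
    (A := fun t' => E.U t' r) (E.continuousOn_left hr0)
    (fun t' ht' => E.norm_bound r t' hr0 ht'.1 ht'.2) (s₀ := t) ⟨hrt, ht⟩
    (show 0 < ε / 3 by positivity)
  have hle : nhdsWithin t (Icc 0 T) ≤ nhdsWithin t (Icc r T) :=
    le_inf (nhdsWithin_le_nhds) (Filter.le_principal_iff.2 hmem)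
  filter_upwards [hle hev, hmem,
    mem_nhdsWithin_of_mem_nhds (Iio_mem_nhds (show t < t + η by linarith))] with t' h1 h2 h3 F hF
  have hF' : ‖F‖ ≤ M := by simpa using hF
  have e1 := E.norm_duhamel_sub_apply_le hT hF' hr0 h2.1 h2.2
  have e2 := E.norm_duhamel_sub_apply_le hT hF' hr0 hrt ht
  have e3 := h1 _ ⟨F, hF, rfl⟩
  have hCM : 0 ≤ E.C * M := by positivity
  have b1 : E.C * M * (t' - r) ≤ E.C * M * (2 * η) :=
    mul_le_mul_of_nonneg_left (by linarith [mem_Iio.1 h3]) hCM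
  have b2 : E.C * M * (t - r) ≤ E.C * M * η := mul_le_mul_of_nonneg_left htr hCM
  set V := E.duhamel hT F
  have heq : V t' - V t = (V t' - E.U t' r (V r)) + (E.U t' r (V r) - E.U t r (V r)) -
      (V t - E.U t r (V r)) := by abel
  rw [heq]
  have n1 := norm_sub_le ((V t' - E.U t' r (V r)) + (E.U t' r (V r) - E.U t r (V r)))
      (V t - E.U t r (V r))
  have n2 := norm_add_le (V t' - E.U t' r (V r)) (E.U t' r (V r) - E.U t r (V r))
  linarith

theorem continuousOn_duhamel (E : CompactEvolutionFamily T X) (hT : 0 ≤ T)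
    (F : C(Icc (0 : ℝ) T, X)) : ContinuousOn (E.duhamel hT F) (Icc 0 T) := by
  intro t ht
  refine Metric.tendsto_nhds.2 fun ε hε => ?_
  filter_upwards [E.eventually_norm_duhamel_sub_lt hT (norm_nonneg F) ht.1 ht.2 hε] with t' h
  rw [dist_eq_norm]
  exact h F (by simp)

/-- The mild solution operator as a map into the space of continuous functions. -/
noncomputable def duhamelMap (E : CompactEvolutionFamily T X) (hT : 0 ≤ T)
    (F : C(Icc (0 : ℝ) T, X)) : C(Icc (0 : ℝ) T, X) :=
  ⟨fun t => E.duhamel hT F t, (E.continuousOn_duhamel hT F).domRestrict⟩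

theorem continuous_duhamelMap (E : CompactEvolutionFamily T X) (hT : 0 ≤ T) :
    Continuous (E.duhamelMap hT) := by
  have hC := E.C_nonneg
  refine (LipschitzWith.of_dist_le_mul (K := (E.C * T).toNNReal) fun F F' => ?_).continuous
  refine (ContinuousMap.dist_le (by positivity)).2 fun t => ?_
  rw [dist_eq_norm, dist_eq_norm]
  refine (le_of_eq ?_).trans ((E.norm_duhamel_le hT (F := F - F') le_rfl t.2.1 t.2.2).trans_eq ?_)
  · exact congrArg norm (E.duhamel_sub hT F F' t.2.2)
  · rw [Real.coe_toNNReal _ (by positivity)]; ring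

theorem isCompact_closure_image_duhamelMap (E : CompactEvolutionFamily T X) (hT : 0 ≤ T) {M : ℝ}
    (hM : 0 ≤ M) : IsCompact (closure (E.duhamelMap hT '' Metric.closedBall 0 M)) := by
  refine isCompact_closure_of_equicontinuous (fun t => ?_) fun t => ?_
  · refine Metric.equicontinuousAt_iff_right.2 fun ε hε => ?_
    have hev := E.eventually_norm_duhamel_sub_lt hT hM t.2.1 t.2.2 hε
    rw [← map_nhds_subtype_val t] at hev
    filter_upwards [Filter.eventually_map.1 hev] with t' ht'
    rintro ⟨_, F, hF, rfl⟩
    rw [dist_comm, dist_eq_norm]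
    exact ht' F hF
  · rw [image_image]
    exact E.totallyBounded_duhamel hT hM t.2.1 t.2.2

end CompactEvolutionFamily

/-- Existence of a mild solution of the non-autonomous semilinear system
`x'(t) = A(t)x(t) + f(t,x(t)) + B u(t)`, `x(0) = x₀`, with the feedback control
`u = Φ(x)`, where `f` is continuous and uniformly bounded and `Φ` is a continuous,
uniformly bounded map from `C([0,T];X)` to `C([0,T];H)`. -/
theorem exists_mild_solution_feedback
    {X H : Type*} [NormedAddCommGroup X] [NormedSpace ℝ X] [CompleteSpace X]
    [NormedAddCommGroup H] [InnerProductSpace ℝ H]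
    (T : ℝ) (hT : 0 < T) (E : CompactEvolutionFamily T X)
    (B : H →L[ℝ] X) (x₀ : X)
    (f : ℝ → X → X) (K : ℝ) (hK : 0 < K)
    (hf_cont : ContinuousOn (fun q : ℝ × X => f q.1 q.2) (Icc (0:ℝ) T ×ˢ (univ : Set X)))
    (hf_bdd : ∀ t ∈ Icc (0:ℝ) T, ∀ x : X, ‖f t x‖ ≤ K)
    (Φ : C(Icc (0:ℝ) T, X) → C(Icc (0:ℝ) T, H)) (M₀ : ℝ) (hM₀ : 0 < M₀)
    (hΦ_cont : Continuous Φ)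
    (hΦ_bdd : ∀ (x : C(Icc (0:ℝ) T, X)) (t : Icc (0:ℝ) T), ‖Φ x t‖ ≤ M₀) :
    ∃ x : C(Icc (0:ℝ) T, X), ∀ t : Icc (0:ℝ) T,
      x t = E.U (t:ℝ) 0 x₀ + ∫ s in Icc (0:ℝ) (t:ℝ),
        E.U (t:ℝ) s (f s (IccExtend hT.le x s) + B (IccExtend hT.le (Φ x) s)) := by
  have hcont : Continuous fun p : C(Icc (0:ℝ) T, X) × Icc (0:ℝ) T =>
      f p.2 (p.1 p.2) + B (Φ p.1 p.2) := by
    refine Continuous.add ?_ ?_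
    · refine hf_cont.comp_continuous
        (f := fun p : C(Icc (0:ℝ) T, X) × Icc (0:ℝ) T => ((p.2 : ℝ), p.1 p.2)) (by fun_prop) ?_
      exact fun p => ⟨p.2.2, mem_univ _⟩
    · fun_prop
  set N : C(C(Icc (0:ℝ) T, X), C(Icc (0:ℝ) T, X)) := ContinuousMap.curry ⟨_, hcont⟩ with hN
  have hNbdd : ∀ x, ‖N x‖ ≤ K + ‖B‖ * M₀ := fun x =>
    (ContinuousMap.norm_le _ (by positivity)).2 fun t =>
      norm_add_le_of_le (hf_bdd t t.2 _) (B.le_opNorm_of_le (hΦ_bdd x t))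
  set v : C(Icc (0:ℝ) T, X) :=
    ⟨fun t => E.U t 0 x₀, (E.continuousOn_left le_rfl x₀).domRestrict⟩ with hv
  obtain ⟨x, hx⟩ := exists_fixedPoint_of_mem_compact
    (G := fun x => v + E.duhamelMap hT.le (N x))
    (continuous_const.add ((E.continuous_duhamelMap hT.le).comp N.continuous))
    ((E.isCompact_closure_image_duhamelMap hT.le
      (show 0 ≤ K + ‖B‖ * M₀ by positivity)).image (continuous_const_add v))
    fun x => ⟨_, subset_closure ⟨N x, by simpa using hNbdd x, rfl⟩, rfl⟩
  refine ⟨x, fun t => ?_⟩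
  have hxt : E.U t 0 x₀ + E.duhamel hT.le (N x) t = x t := DFunLike.congr_fun hx t
  rw [← hxt, CompactEvolutionFamily.duhamel]
  congr 1
  refine setIntegral_congr_fun measurableSet_Icc fun s hs => ?_
  have hsT : s ∈ Icc (0:ℝ) T := ⟨hs.1, hs.2.trans t.2.2⟩
  simp only [IccExtend_of_mem _ _ hsT]
  rfl
end

section
/- Let p ≥ 2 be a real number and λ ∈ ℝ. Let f : [0,π] → ℝ be twice continuously differentiable with f(0) = f(π) = 0, and set g(ξ) = λ f(ξ) − f''(ξ) for ξ ∈ [0,π]. Then the energy identity λ ∫₀^π |f(ξ)|^p dξ + (p−1) ∫₀^π |f(ξ)|^{p−2} f'(ξ)² dξ = ∫₀^π g(ξ) f(ξ) |f(ξ)|^{p−2} dξ holds, where for p = 2 the factor |f(ξ)|^{p−2} is interpreted as 1. -/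
open MeasureTheory Set Real

/-- The function `y ↦ y * |y| ^ s` is differentiable for `0 ≤ s`, with the convention
`0 ^ 0 = 1` in the derivative at the origin. -/
theorem hasDerivAt_mul_abs_rpow {s : ℝ} (hs : 0 ≤ s) (y : ℝ) :
    HasDerivAt (fun x : ℝ ↦ x * |x| ^ s) ((s + 1) * |y| ^ s) y := by
  rcases eq_or_ne y 0 with rfl | hy
  · have h0 : (s + 1) * |(0 : ℝ)| ^ s = |(0 : ℝ)| ^ s := by
      rcases hs.eq_or_lt with rfl | hs
      · simp
      · simp [zero_rpow hs.ne']
    rw [h0, hasDerivAt_iff_tendsto_slope]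
    have hcont : Continuous fun x : ℝ ↦ |x| ^ s := continuous_abs.rpow_const fun _ ↦ Or.inr hs
    refine (hcont.continuousAt.tendsto.mono_left nhdsWithin_le_nhds).congr' ?_
    filter_upwards [self_mem_nhdsWithin] with x hx
    have hx : x ≠ 0 := hx
    simp [slope_def_field, hx]
  · have hy' : |y| ≠ 0 := abs_ne_zero.2 hy
    refine ((hasDerivAt_id y).mul
      ((hasDerivAt_abs hy).rpow_const (p := s) (Or.inl hy'))).congr_deriv ?_
    have hsign : y * (SignType.sign y : ℝ) = |y| := self_mul_sign y
    have hpow : |y| * |y| ^ (s - 1) = |y| ^ s := by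
      rw [rpow_sub_one hy']
      field_simp
    simp only [id]
    linear_combination (s * |y| ^ (s - 1)) * hsign + s * hpow

/-- Integration by parts against `f * |f| ^ s` for `f` vanishing at both end points. -/
theorem integral_deriv_mul_abs_rpow_of_dirichlet {a b s : ℝ} (hab : a ≤ b) (hs : 0 ≤ s)
    {f f' f'' : ℝ → ℝ}
    (hf' : ∀ x ∈ Icc a b, HasDerivWithinAt f (f' x) (Icc a b) x)
    (hf'' : ∀ x ∈ Icc a b, HasDerivWithinAt f' (f'' x) (Icc a b) x)
    (hf''_cont : ContinuousOn f'' (Icc a b)) (ha : f a = 0) (hb : f b = 0) :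
    ∫ x in Icc a b, (f'' x * (f x * |f x| ^ s) + f' x * ((s + 1) * |f x| ^ s * f' x)) = 0 := by
  have hfc : ContinuousOn f (Icc a b) := fun x hx ↦ (hf' x hx).continuousWithinAt
  have hf'c : ContinuousOn f' (Icc a b) := fun x hx ↦ (hf'' x hx).continuousWithinAt
  have hpow : ContinuousOn (fun x ↦ |f x| ^ s) (Icc a b) :=
    hfc.abs.rpow_const fun _ _ ↦ Or.inr hs
  rw [integral_Icc_eq_integral_Ioc, ← intervalIntegral.integral_of_le hab,
    ← uIcc_of_le hab] at *
  refine (intervalIntegral.integral_deriv_mul_eq_sub_of_hasDerivWithinAt hf''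
    (fun x hx ↦ (hasDerivAt_mul_abs_rpow hs (f x)).comp_hasDerivWithinAt x (hf' x hx))
    hf''_cont.intervalIntegrable
    ((continuousOn_const.mul hpow).mul hf'c).intervalIntegrable).trans ?_
  simp [ha, hb]

/-- Energy identity for the Dirichlet problem on `[0,π]`: if `f` is twice continuously
differentiable on `[0,π]` with `f(0) = f(π) = 0` and `g = λf − f''`, then for any real
`p ≥ 2`, `λ∫|f|^p + (p−1)∫|f|^{p−2}(f')² = ∫ g f |f|^{p−2}` (integrals over `[0,π]`). -/
theorem dirichlet_energy_identity
    (p lam : ℝ) (hp : 2 ≤ p)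
    (f f' f'' : ℝ → ℝ)
    (hf' : ∀ ξ ∈ Icc (0:ℝ) π, HasDerivWithinAt f (f' ξ) (Icc (0:ℝ) π) ξ)
    (hf'' : ∀ ξ ∈ Icc (0:ℝ) π, HasDerivWithinAt f' (f'' ξ) (Icc (0:ℝ) π) ξ)
    (hf''_cont : ContinuousOn f'' (Icc (0:ℝ) π))
    (hf0 : f 0 = 0) (hfπ : f π = 0) :
    lam * (∫ ξ in Icc (0:ℝ) π, |f ξ| ^ p)
        + (p - 1) * (∫ ξ in Icc (0:ℝ) π, |f ξ| ^ (p - 2) * (f' ξ) ^ 2)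
      = ∫ ξ in Icc (0:ℝ) π, (lam * f ξ - f'' ξ) * f ξ * |f ξ| ^ (p - 2) := by
  have hs : 0 ≤ p - 2 := by linarith
  have hfc : ContinuousOn f (Icc 0 π) := fun x hx ↦ (hf' x hx).continuousWithinAt
  have hf'c : ContinuousOn f' (Icc 0 π) := fun x hx ↦ (hf'' x hx).continuousWithinAt
  have hpow : ContinuousOn (fun x ↦ |f x| ^ (p - 2)) (Icc 0 π) :=
    hfc.abs.rpow_const fun _ _ ↦ Or.inr hs
  have hpow_p (y : ℝ) : |y| ^ p = y * y * |y| ^ (p - 2) := by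
    rw [← abs_mul_abs_self y, ← sq, ← rpow_natCast,
      ← rpow_add_of_nonneg (abs_nonneg y) (by norm_num) hs]
    norm_num
  have hI₁ : IntegrableOn (fun ξ ↦ |f ξ| ^ p) (Icc 0 π) :=
    (hfc.abs.rpow_const fun _ _ ↦ Or.inr (by linarith)).integrableOn_Icc
  have hI₂ : IntegrableOn (fun ξ ↦ |f ξ| ^ (p - 2) * f' ξ ^ 2) (Icc 0 π) :=
    (hpow.mul (hf'c.pow 2)).integrableOn_Icc
  have hI₃ : IntegrableOn (fun ξ ↦ (lam * f ξ - f'' ξ) * f ξ * |f ξ| ^ (p - 2)) (Icc 0 π) :=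
    ((((continuousOn_const.mul hfc).sub hf''_cont).mul hfc).mul hpow).integrableOn_Icc
  have hI₁₂ : IntegrableOn
      (fun ξ ↦ lam * |f ξ| ^ p + (p - 1) * (|f ξ| ^ (p - 2) * f' ξ ^ 2)) (Icc 0 π) :=
    (hI₁.const_mul lam).add (hI₂.const_mul (p - 1))
  rw [← sub_eq_zero, ← integral_const_mul, ← integral_const_mul,
    ← integral_add (hI₁.const_mul lam) (hI₂.const_mul (p - 1)),
    ← integral_sub hI₁₂ hI₃]
  refine Eq.trans ?_
    (integral_deriv_mul_abs_rpow_of_dirichlet pi_pos.le hs hf' hf'' hf''_cont hf0 hfπ)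
  congr 1 with ξ
  simp only [hpow_p]
  ring
end

section
/- Let p ≥ 2 be a real number, λ > 0, and let a : [0,π] → ℝ be continuous with δ ≤ a(ξ) ≤ M for all ξ ∈ [0,π], where 0 < δ ≤ M. Let f : [0,π] → ℝ be twice continuously differentiable with f(0) = f(π) = 0, and set g(ξ) = λ f(ξ) − a(ξ) f''(ξ) for ξ ∈ [0,π]. Then (∫₀^π |f(ξ)|^p dξ)^{1/p} ≤ ( M/(λ δ) ) (∫₀^π |g(ξ)|^p dξ)^{1/p}; i.e., the resolvent of the variable-coefficient operator A(t)f = a(t,·) f'' with Dirichlet boundary conditions satisfies ‖R(λ, A(t))g‖_{L^p} ≤ M/(λδ) ‖g‖_{L^p} for all λ > 0. -/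
open MeasureTheory Set Real

/-- The derivative of the duality map `x ↦ |x| ^ (p - 2) * x` of `L^p`. -/
theorem hasDerivAt_abs_rpow_sub_two_mul_self {p : ℝ} (hp : 2 ≤ p) (x : ℝ) :
    HasDerivAt (fun y : ℝ => |y| ^ (p - 2) * y) ((p - 1) * |x| ^ (p - 2)) x := by
  rcases eq_or_ne x 0 with rfl | hx
  · have hval : (p - 1) * |(0 : ℝ)| ^ (p - 2) = |(0 : ℝ)| ^ (p - 2) := by
      rcases eq_or_lt_of_le hp with rfl | h
      · norm_num
      · simp [Real.zero_rpow (sub_pos.2 h).ne']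
    rw [hval, hasDerivAt_iff_tendsto_slope]
    have hc : Continuous fun y : ℝ => |y| ^ (p - 2) :=
      continuous_abs.rpow_const fun _ => Or.inr (by linarith)
    refine ((hc.tendsto 0).mono_left nhdsWithin_le_nhds).congr' ?_
    filter_upwards [self_mem_nhdsWithin] with y hy
    have hy0 : y ≠ 0 := hy
    simp [slope_def_field, hy0]
  · have hpow := (hasDerivAt_abs hx).rpow_const (p := p - 2) (Or.inl (abs_ne_zero.2 hx))
    refine (hpow.mul (hasDerivAt_id' x)).congr_deriv ?_
    have hsplit : |x| ^ (p - 2) = |x| ^ (p - 2 - 1) * |x| := by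
      rw [← Real.rpow_add_one (abs_ne_zero.2 hx)]
      congr 1
      ring
    have hsign : (SignType.sign x : ℝ) * x = |x| := sign_mul_self x
    rw [hsplit]
    linear_combination ((p - 2) * |x| ^ (p - 2 - 1)) * hsign

/-- Absorbing form of Young's inequality. -/
theorem rpow_le_rpow_add_mul_of_le_mul_rpow_sub_one_add {p x y r : ℝ} (hp : 1 < p) (hx : 0 ≤ x)
    (hy : 0 ≤ y) (h : x ^ p ≤ y * x ^ (p - 1) + r) : x ^ p ≤ y ^ p + p * r := by
  have hp0 : 0 < p := by linarith
  have hY := Real.young_inequality_of_nonneg hy (Real.rpow_nonneg hx (p - 1))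
    (Real.HolderConjugate.conjExponent hp)
  rw [Real.conjExponent, ← Real.rpow_mul hx, mul_div_cancel₀ _ (by linarith : p - 1 ≠ 0)] at hY
  have hY' : y * x ^ (p - 1) * p ≤ y ^ p + (p - 1) * x ^ p := by
    calc y * x ^ (p - 1) * p ≤ (y ^ p / p + x ^ p / (p / (p - 1))) * p := by gcongr
      _ = y ^ p + (p - 1) * x ^ p := by field_simp
  nlinarith

/-- Resolvent estimate for the variable-coefficient operator `A f = a·f''` with
Dirichlet boundary conditions on `L^p(0,π)`, `p ≥ 2`: if `δ ≤ a(ξ) ≤ M` with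
`0 < δ ≤ M`, `f` is twice continuously differentiable on `[0,π]` with
`f(0) = f(π) = 0` and `g = λf − a f''` with `λ > 0`, then
`‖f‖_{L^p} ≤ (M/(λδ)) ‖g‖_{L^p}`, i.e. `‖R(λ,A)g‖_{L^p} ≤ M/(λδ) ‖g‖_{L^p}`. -/
theorem variable_coefficient_resolvent_estimate
    (p lam δ M : ℝ) (hp : 2 ≤ p) (hlam : 0 < lam) (hδ : 0 < δ) (hδM : δ ≤ M)
    (a : ℝ → ℝ) (ha_cont : ContinuousOn a (Icc (0:ℝ) π))
    (ha : ∀ ξ ∈ Icc (0:ℝ) π, δ ≤ a ξ ∧ a ξ ≤ M)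
    (f f' f'' : ℝ → ℝ)
    (hf' : ∀ ξ ∈ Icc (0:ℝ) π, HasDerivWithinAt f (f' ξ) (Icc (0:ℝ) π) ξ)
    (hf'' : ∀ ξ ∈ Icc (0:ℝ) π, HasDerivWithinAt f' (f'' ξ) (Icc (0:ℝ) π) ξ)
    (hf''_cont : ContinuousOn f'' (Icc (0:ℝ) π))
    (hf0 : f 0 = 0) (hfπ : f π = 0) :
    (∫ ξ in Icc (0:ℝ) π, |f ξ| ^ p) ^ (1 / p)
      ≤ (M / (lam * δ)) * (∫ ξ in Icc (0:ℝ) π, |lam * f ξ - a ξ * f'' ξ| ^ p) ^ (1 / p) := by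
  have hM : 0 < M := hδ.trans_le hδM
  have hp0 : 0 < p := by linarith
  set c := M / (lam * δ) with hc
  have hc0 : 0 < c := by positivity
  have hfc : ContinuousOn f (Icc 0 π) := fun ξ hξ => (hf' ξ hξ).continuousWithinAt
  have hfc' : ContinuousOn f' (Icc 0 π) := fun ξ hξ => (hf'' ξ hξ).continuousWithinAt
  set g : ℝ → ℝ := fun ξ => lam * f ξ - a ξ * f'' ξ with hg
  have hgc : ContinuousOn g (Icc 0 π) := by fun_prop
  set D : ℝ → ℝ := fun ξ =>
    (p - 1) * |f ξ| ^ (p - 2) * f' ξ * f' ξ + |f ξ| ^ (p - 2) * f ξ * f'' ξ with hD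
  have hrpow : ∀ {h : ℝ → ℝ} {q : ℝ}, ContinuousOn h (Icc 0 π) → 0 ≤ q →
      ContinuousOn (fun ξ => |h ξ| ^ q) (Icc 0 π) :=
    fun hh hq => hh.abs.rpow_const fun _ _ => Or.inr hq
  have hf2 := hrpow hfc (by linarith : 0 ≤ p - 2)
  have hDc : ContinuousOn D (Icc 0 π) := by fun_prop
  have hD0 : ∫ ξ in Icc 0 π, D ξ = 0 := by
    rw [integral_Icc_eq_integral_Ioc, ← intervalIntegral.integral_of_le pi_pos.le,
      intervalIntegral.integral_eq_sub_of_hasDerivAt_of_le pi_pos.le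
        (f := fun ξ => |f ξ| ^ (p - 2) * f ξ * f' ξ) (by fun_prop) _
        (hDc.intervalIntegrable_of_Icc pi_pos.le)]
    · simp [hf0, hfπ]
    · intro ξ hξ
      have hmem := Ioo_subset_Icc_self hξ
      have hnhds := Icc_mem_nhds hξ.1 hξ.2
      exact ((hasDerivAt_abs_rpow_sub_two_mul_self hp (f ξ)).comp ξ
        ((hf' ξ hmem).hasDerivAt hnhds)).mul ((hf'' ξ hmem).hasDerivAt hnhds)
  have hpoint : ∀ ξ ∈ Icc 0 π, |f ξ| ^ p ≤ c ^ p * |g ξ| ^ p + p * (M / lam) * D ξ := by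
    intro ξ hξ
    obtain ⟨haδ, haM⟩ := ha ξ hξ
    have ha0 : 0 < a ξ := hδ.trans_le haδ
    rw [← Real.mul_rpow hc0.le (abs_nonneg _), mul_assoc]
    refine rpow_le_rpow_add_mul_of_le_mul_rpow_sub_one_add (by linarith) (abs_nonneg _)
      (by positivity) ?_
    have hsub_one : |f ξ| ^ (p - 1) = |f ξ| ^ (p - 2) * |f ξ| := by
      rw [← Real.rpow_add_one' (abs_nonneg _) (by linarith)]
      congr 1
      ring
    have hpow : |f ξ| ^ p = |f ξ| ^ (p - 2) * f ξ * f ξ := by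
      rw [mul_assoc, ← abs_mul_abs_self (f ξ), ← mul_assoc, ← hsub_one,
        ← Real.rpow_add_one' (abs_nonneg _) (by linarith)]
      congr 1
      ring
    have heq : lam / a ξ * |f ξ| ^ p
        = |f ξ| ^ (p - 2) * f ξ * g ξ / a ξ + |f ξ| ^ (p - 2) * f ξ * f'' ξ := by
      rw [hpow, hg]
      field_simp
      ring
    have hlower : lam / M * |f ξ| ^ p ≤ lam / a ξ * |f ξ| ^ p := by gcongr
    have hupper : |f ξ| ^ (p - 2) * f ξ * g ξ / a ξ ≤ |f ξ| ^ (p - 1) * |g ξ| / δ := by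
      calc |f ξ| ^ (p - 2) * f ξ * g ξ / a ξ ≤ |f ξ| ^ (p - 1) * |g ξ| / a ξ := by
            rw [hsub_one, mul_assoc, mul_assoc, ← abs_mul]
            gcongr
            exact le_abs_self _
        _ ≤ _ := by gcongr
    have hDle : |f ξ| ^ (p - 2) * f ξ * f'' ξ ≤ D ξ := by
      have : 0 ≤ (p - 1) * |f ξ| ^ (p - 2) * (f' ξ * f' ξ) :=
        mul_nonneg (mul_nonneg (by linarith) (by positivity)) (mul_self_nonneg _)
      simp only [hD]
      linarith
    calc |f ξ| ^ p = M / lam * (lam / M * |f ξ| ^ p) := by field_simp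
      _ ≤ M / lam * (|f ξ| ^ (p - 1) * |g ξ| / δ + D ξ) := by
        gcongr
        linarith
      _ = c * |g ξ| * |f ξ| ^ (p - 1) + M / lam * D ξ := by
        rw [hc]
        field_simp
  have hfp := (hrpow hfc hp0.le).integrableOn_Icc (μ := volume)
  have hgp := ((hrpow hgc hp0.le).integrableOn_Icc (μ := volume)).const_mul (c ^ p)
  have hDi := (hDc.integrableOn_Icc (μ := volume)).const_mul (p * (M / lam))
  have hint : ∫ ξ in Icc 0 π, |f ξ| ^ p ≤ c ^ p * ∫ ξ in Icc 0 π, |g ξ| ^ p := by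
    calc ∫ ξ in Icc 0 π, |f ξ| ^ p
        ≤ ∫ ξ in Icc 0 π, (c ^ p * |g ξ| ^ p + p * (M / lam) * D ξ) :=
          setIntegral_mono_on hfp (hgp.add hDi) measurableSet_Icc hpoint
      _ = c ^ p * ∫ ξ in Icc 0 π, |g ξ| ^ p := by
        rw [integral_add hgp hDi, integral_const_mul, integral_const_mul, hD0, mul_zero, add_zero]
  have hg0 : 0 ≤ ∫ ξ in Icc 0 π, |g ξ| ^ p := integral_nonneg fun ξ => by positivity
  calc (∫ ξ in Icc 0 π, |f ξ| ^ p) ^ (1 / p)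
      ≤ (c ^ p * ∫ ξ in Icc 0 π, |g ξ| ^ p) ^ (1 / p) :=
        Real.rpow_le_rpow (integral_nonneg fun ξ => by positivity) hint (by positivity)
    _ = c * (∫ ξ in Icc 0 π, |g ξ| ^ p) ^ (1 / p) := by
      rw [Real.mul_rpow (by positivity) hg0, ← Real.rpow_mul hc0.le, mul_one_div_cancel hp0.ne',
        Real.rpow_one]
end
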